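/- arXiv:2511.10759 — 2 statements merged into one kernel-verified Lean document; each statement's English description precedes it below -/
import Mathlib

section
/- Assume the conventions: X is an infinite, connected, locally finite, vertex-transitive simple graph satisfying (UBQ) with separation constant σ > 0. Then X is one-ended: for every finite set K ⊆ V, the set V ∖ K has exactly one infinite connected component. -/
open SimpleGraph

/-- Closed `r`-neighbourhood of a set `A` in the graph metric of `X`. -/
def gnbhd {V : Type*} (X : SimpleGraph V) (A : Set V) (r : ℝ) : Set V :=
  {v : V | ∃ a ∈ A, (X.dist v a : ℝ) ≤ r}

/-- The induced subgraph on `Z` is connected. -/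
def ConnSet {V : Type*} (X : SimpleGraph V) (Z : Set V) : Prop :=
  (X.induce Z).Connected

/-- `U` is a connected component of the subset `S` of the vertex set: `U` is a
nonempty connected subset of `S` which is maximal among connected subsets of `S`. -/
def IsCompOf {V : Type*} (X : SimpleGraph V) (U S : Set V) : Prop :=
  U ⊆ S ∧ U.Nonempty ∧ ConnSet X U ∧
    ∀ U' : Set V, U ⊆ U' → U' ⊆ S → ConnSet X U' → U' = U

/-- A subset `Z` is narrow if it is quasi-isometric to a subset of `ℝ`
with respect to the ambient graph metric. -/
def Narrow {V : Type*} (X : SimpleGraph V) (Z : Set V) : Prop :=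
  ∃ (lam c : ℝ) (f : Z → ℝ), 1 ≤ lam ∧ 0 ≤ c ∧
    ∀ x y : Z, |f x - f y| ≤ lam * (X.dist x.1 y.1 : ℝ) + c ∧
      (X.dist x.1 y.1 : ℝ) ≤ lam * |f x - f y| + c

/-- A subset is wide if it is not narrow. -/
def Wide {V : Type*} (X : SimpleGraph V) (Z : Set V) : Prop := ¬ Narrow X Z

/-- `ρ : ℤ → V` is a bi-infinite `(lam, c)`-quasi-geodesic path. -/
def IsBiQG {V : Type*} (X : SimpleGraph V) (lam c : ℝ) (ρ : ℤ → V) : Prop :=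
  (∀ n : ℤ, X.Adj (ρ n) (ρ (n + 1))) ∧
    ∀ s t : ℤ, |(s : ℝ) - (t : ℝ)| / lam - c ≤ (X.dist (ρ s) (ρ t) : ℝ)

/-- A bi-infinite quasi-geodesic: a bi-infinite path which is a
`(lam, c)`-quasi-geodesic for some `lam ≥ 1`, `c ≥ 0`. -/
def IsBiQuasiGeodesic {V : Type*} (X : SimpleGraph V) (ρ : ℤ → V) : Prop :=
  ∃ lam c : ℝ, 1 ≤ lam ∧ 0 ≤ c ∧ IsBiQG X lam c ρ

/-- The subset `S` has exactly two wide connected components. -/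
def TwoWideComps {V : Type*} (X : SimpleGraph V) (S : Set V) : Prop :=
  ∃ U₁ U₂ : Set V, U₁ ≠ U₂ ∧
    IsCompOf X U₁ S ∧ IsCompOf X U₂ S ∧ Wide X U₁ ∧ Wide X U₂ ∧
    ∀ U : Set V, IsCompOf X U S → Wide X U → U = U₁ ∨ U = U₂

/-- The uniformly bisecting quasi-geodesics property with separation constant `σ`. -/
def UBQ {V : Type*} (X : SimpleGraph V) (σ : ℝ) : Prop :=
  ∀ ρ : ℤ → V, IsBiQuasiGeodesic X ρ →
    TwoWideComps X ((gnbhd X (Set.range ρ) σ)ᶜ)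

/-- One-way infinite path. -/
def IsRay {V : Type*} (X : SimpleGraph V) (w : ℕ → V) : Prop :=
  ∀ n : ℕ, X.Adj (w n) (w (n + 1))

/-- `d(w t, A) → ∞` as `t → ∞`. -/
def DivergesFrom {V : Type*} (X : SimpleGraph V) (w : ℕ → V) (A : Set V) : Prop :=
  ∀ M : ℝ, ∃ N : ℕ, ∀ t : ℕ, N ≤ t → ∀ a ∈ A, M < (X.dist (w t) a : ℝ)

/-- `(w₁, w₂)` is a pair of witnesses for the bi-infinite quasi-geodesic `ρ`:
they are one-way infinite simple paths lying in distinct wide components of the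
complement of `N_σ(ρ(ℤ))`, both diverging from `ρ`. -/
def WitnessPair {V : Type*} (X : SimpleGraph V) (σ : ℝ) (ρ : ℤ → V)
    (w₁ w₂ : ℕ → V) : Prop :=
  IsRay X w₁ ∧ Function.Injective w₁ ∧ IsRay X w₂ ∧ Function.Injective w₂ ∧
  (∃ U₁ U₂ : Set V, U₁ ≠ U₂ ∧
    IsCompOf X U₁ ((gnbhd X (Set.range ρ) σ)ᶜ) ∧ Wide X U₁ ∧
    IsCompOf X U₂ ((gnbhd X (Set.range ρ) σ)ᶜ) ∧ Wide X U₂ ∧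
    Set.range w₁ ⊆ U₁ ∧ Set.range w₂ ⊆ U₂) ∧
  DivergesFrom X w₁ (Set.range ρ) ∧ DivergesFrom X w₂ (Set.range ρ)

/-- Concatenation of the reversal of the ray `a` with the ray `b`, as a
bi-infinite path (`t ↦ a (-t)` for `t ≤ 0` and `t ↦ b t` for `t ≥ 0`). -/
def biconcat {V : Type*} (a b : ℕ → V) : ℤ → V :=
  fun t => if t < 0 then a (-t).toNat else b t.toNat

/-- One-way infinite `(lam, c)`-quasi-geodesic ray. -/
def IsQGRay {V : Type*} (X : SimpleGraph V) (lam c : ℝ) (γ : ℕ → V) : Prop :=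
  IsRay X γ ∧
    ∀ s t : ℕ, |(s : ℝ) - (t : ℝ)| / lam - c ≤ (X.dist (γ s) (γ t) : ℝ)

/-- An `(R, r, lam, c)`-cross-examiner, with the three rays `γ i`, the three
witnesses `w i` and the three finite paths `q i` (of length `qn i`) indexed by
`ZMod 3` (where the paper's index `3` corresponds to `0 : ZMod 3`). -/
def IsCrossExaminer {V : Type*} (X : SimpleGraph V) (σ R r lam c : ℝ) (v₀ : V)
    (γ w : ZMod 3 → ℕ → V) (q : ZMod 3 → ℕ → V) (qn : ZMod 3 → ℕ) : Prop :=
  1 ≤ lam ∧ 0 ≤ c ∧ 10 * σ < r ∧ r < R ∧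
  (∀ i : ZMod 3, IsQGRay X lam c (γ i) ∧ γ i 0 = v₀ ∧ IsRay X (w i) ∧
    (∀ j : ℕ, j < qn i → X.Adj (q i j) (q i (j + 1)))) ∧
  ∀ i : ZMod 3,
    -- (CE1)
    IsBiQG X lam c (biconcat (γ (i + 1)) (γ (i + 2))) ∧
    -- (CE2)
    (∃ U : Set V,
      IsCompOf X U (Set.range (biconcat (γ (i + 1)) (γ (i + 2))) \
        gnbhd X (q 0 '' Set.Iic (qn 0) ∪ q 1 '' Set.Iic (qn 1) ∪ q 2 '' Set.Iic (qn 2))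
          (10 * σ)) ∧ w i 0 ∈ U ∧ v₀ ∈ U) ∧
    -- (CE3)
    WitnessPair X σ (biconcat (γ (i + 1)) (γ (i + 2))) (w i) (γ i) ∧
    -- (CE4)
    (∀ t : ℕ, r < (t : ℝ) → ∀ s : ℤ,
      10 * σ < (X.dist (w i t) (biconcat (γ (i + 1)) (γ (i + 2)) s) : ℝ)) ∧
    -- (CE5)
    (q i 0 ∈ Set.range (γ (i + 1)) ∧ q i (qn i) ∈ Set.range (γ (i + 2)) ∧
      (q i '' Set.Iic (qn i)) ∩
        gnbhd X (Set.range (w (i + 1)) ∪ Set.range (w (i + 2)) ∪ Set.range (γ i))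
          (10 * σ) = ∅) ∧
    -- (CE6)
    q i '' Set.Iic (qn i) ⊆ gnbhd X {v₀} (R - 10 * σ) \ gnbhd X {v₀} (r + 10 * σ)

/-- `X` has quadratic growth. -/
def QuadGrowth {V : Type*} (X : SimpleGraph V) : Prop :=
  ∃ C : ℝ, 0 < C ∧ ∀ v : V, ∀ n : ℕ, 1 ≤ n →
    ({u : V | X.dist u v ≤ n}.ncard : ℝ) ≤ C * (n : ℝ) ^ 2

/-- The set of vertices at distance exactly `1` from `A`. -/
def vertexBoundary {V : Type*} (X : SimpleGraph V) (A : Set V) : Set V :=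
  {v : V | v ∉ A ∧ ∃ a ∈ A, X.Adj v a}

/-- The depth of `A`: `inf {r ≥ 0 : A ⊆ N_r(∂A)}`. -/
noncomputable def gdepth {V : Type*} (X : SimpleGraph V) (A : Set V) : ℝ :=
  sInf {r : ℝ | 0 ≤ r ∧ A ⊆ gnbhd X (vertexBoundary X A) r}

/-- A `(lam, c)`-quasi-circle of length `n ≥ 1`: a closed path all of whose
subpaths of length at most `n / 2` are `(lam, c)`-quasi-geodesics. -/
def IsQuasiCircle {V : Type*} (X : SimpleGraph V) (lam c : ℝ) (n : ℕ)
    (C : ZMod n → V) : Prop :=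
  1 ≤ n ∧ (∀ k : ZMod n, X.Adj (C k) (C (k + 1))) ∧
    ∀ (k : ZMod n) (m s t : ℕ), 2 * m ≤ n → s ≤ m → t ≤ m →
      |(s : ℝ) - (t : ℝ)| / lam - c ≤
        (X.dist (C (k + (s : ZMod n))) (C (k + (t : ZMod n))) : ℝ)

/-- A truncated `(lam, c)`-quasi-circle with major face `F` (of length `nF`) and
minor face `f` (of length `nf`): `F` is the initial part of a `(lam, c)`-quasi-circle
and `f` is a `(lam, c)`-quasi-geodesic with the same endpoints as the remaining part. -/
def IsTruncQuasiCircle {V : Type*} (X : SimpleGraph V) (lam c : ℝ)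
    (F : ℕ → V) (nF : ℕ) (f : ℕ → V) (nf : ℕ) : Prop :=
  (∀ i : ℕ, i < nF → X.Adj (F i) (F (i + 1))) ∧
  (∀ i : ℕ, i < nf → X.Adj (f i) (f (i + 1))) ∧
  f 0 = F nF ∧ f nf = F 0 ∧
  (∀ s t : ℕ, s ≤ nf → t ≤ nf →
    |(s : ℝ) - (t : ℝ)| / lam - c ≤ (X.dist (f s) (f t) : ℝ)) ∧
  ∃ (n : ℕ) (C : ZMod n → V), IsQuasiCircle X lam c n C ∧ nF ≤ n ∧
    ∀ i : ℕ, i ≤ nF → C (i : ZMod n) = F i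

/-- The graph `X`, with its graph metric, is quasi-isometric to the metric space `Y`. -/
def QIto {V : Type*} (X : SimpleGraph V) (Y : Type*) [PseudoMetricSpace Y] : Prop :=
  ∃ (lam c : ℝ) (f : V → Y), 1 ≤ lam ∧ 0 ≤ c ∧
    (∀ x x' : V, (X.dist x x' : ℝ) / lam - c ≤ dist (f x) (f x') ∧
      dist (f x) (f x') ≤ lam * (X.dist x x' : ℝ) + c) ∧
    ∀ y : Y, ∃ x : V, dist y (f x) ≤ c

/-- The Gromov product `(x · y)_w` in the graph metric. -/
noncomputable def gromovProd {V : Type*} (X : SimpleGraph V) (w x y : V) : ℝ :=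
  ((X.dist x w : ℝ) + (X.dist y w : ℝ) - (X.dist x y : ℝ)) / 2

/-- `X` is Gromov hyperbolic. -/
def GromovHyperbolic {V : Type*} (X : SimpleGraph V) : Prop :=
  ∃ δ : ℝ, 0 ≤ δ ∧ ∀ w x y z : V,
    min (gromovProd X w x z) (gromovProd X w y z) - δ ≤ gromovProd X w x y

namespace OneEnded

variable {V : Type*} {X : SimpleGraph V}

/-- Closed ball of radius `R` about `v`. -/
def cball (X : SimpleGraph V) (v : V) (R : ℕ) : Set V := {x | X.dist v x ≤ R}

/-- `x` and `y` are joined by a walk inside `S`. -/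
def Joined (X : SimpleGraph V) (S : Set V) (x y : V) : Prop :=
  ∃ p : X.Walk x y, ∀ z ∈ p.support, z ∈ S

/-- `A` avoids `B`, and one can leave `A` only through `B`; equivalently, `A` is a union of
connected components of the complement of `B`. -/
def ClosedOff (X : SimpleGraph V) (B A : Set V) : Prop :=
  Disjoint A B ∧ ∀ x ∈ A, ∀ y, X.Adj x y → y ∉ B → y ∈ A

/-- A family of pairwise disjoint infinite sets, each closed off by the ball of radius `R`
about `v`. -/
structure IsSep (X : SimpleGraph V) (v : V) (R : ℕ) {ι : Type} (A : ι → Set V) : Prop where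
  infinite : ∀ i, (A i).Infinite
  closedOff : ∀ i, ClosedOff X (cball X v R) (A i)
  disjoint : ∀ i j, i ≠ j → Disjoint (A i) (A j)

/-! ### Walks inside a set -/

namespace Joined

variable {S T : Set V} {x y z : V}

lemma refl (h : x ∈ S) : Joined X S x x := ⟨.nil, by simpa using h⟩

lemma symm (h : Joined X S x y) : Joined X S y x := by
  obtain ⟨p, hp⟩ := h
  exact ⟨p.reverse, by simpa using hp⟩

lemma trans (h : Joined X S x y) (h' : Joined X S y z) : Joined X S x z := by
  obtain ⟨p, hp⟩ := h
  obtain ⟨q, hq⟩ := h'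
  refine ⟨p.append q, fun w hw => ?_⟩
  rcases (Walk.mem_support_append_iff _ _).1 hw with hw | hw
  exacts [hp w hw, hq w hw]

lemma mono (hST : S ⊆ T) (h : Joined X S x y) : Joined X T x y :=
  h.imp fun _ hp w hw => hST (hp w hw)

lemma of_adj (hx : x ∈ S) (hy : y ∈ S) (h : X.Adj x y) : Joined X S x y :=
  ⟨.cons h .nil, by simp [hx, hy]⟩

lemma right_mem (h : Joined X S x y) : y ∈ S := h.elim fun p hp => hp y p.end_mem_support

end Joined

lemma connSet_of_joined {S : Set V} {x : V} (hx : x ∈ S) (h : ∀ y ∈ S, Joined X S x y) :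
    ConnSet X S := by
  refine X.induce_connected_of_patches x hx fun {y} hy => ?_
  obtain ⟨p, hp⟩ := h y hy
  exact ⟨S, subset_rfl, hx, hy, ⟨p.induce S hp⟩⟩

lemma joined_of_connSet {S : Set V} (h : ConnSet X S) {x y : V} (hx : x ∈ S) (hy : y ∈ S) :
    Joined X S x y := by
  obtain ⟨p⟩ := h.preconnected ⟨x, hx⟩ ⟨y, hy⟩
  have key : ∀ z ∈ (p.map (Embedding.induce S).toHom).support, z ∈ S := by
    intro z hz
    rw [Walk.support_map, List.mem_map] at hz
    obtain ⟨w, -, rfl⟩ := hz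
    exact w.2
  exact ⟨_, key⟩

lemma isCompOf_joined {S : Set V} {x : V} (hx : x ∈ S) :
    IsCompOf X {y | Joined X S x y} S := by
  have key : ∀ y, Joined X S x y → Joined X {y | Joined X S x y} x y := by
    classical
    rintro y ⟨p, hp⟩
    refine ⟨p, fun z hz => ⟨p.takeUntil z hz, fun w hw => hp w ?_⟩⟩
    exact p.support_takeUntil_subset_support hz hw
  refine ⟨fun y hy => hy.right_mem, ⟨x, .refl hx⟩, connSet_of_joined (.refl hx) key, ?_⟩
  intro U' h₁ h₂ h₃
  exact h₁.antisymm' fun y hy => (joined_of_connSet h₃ (h₁ (.refl hx)) hy).mono h₂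

lemma eq_joined_of_isCompOf {S U : Set V} (h : IsCompOf X U S) {x : V} (hx : x ∈ U) :
    U = {y | Joined X S x y} := by
  have hxS := h.1 hx
  refine (h.2.2.2 _ (fun y hy => (joined_of_connSet h.2.2.1 hx hy).mono h.1) ?_ ?_).symm
  exacts [(isCompOf_joined hxS).1, (isCompOf_joined hxS).2.2.1]

lemma closedOff_of_isCompOf {K U : Set V} (h : IsCompOf X U Kᶜ) : ClosedOff X K U := by
  refine ⟨Set.disjoint_left.2 fun x hx => h.1 hx, fun x hx y hxy hy => ?_⟩
  rw [eq_joined_of_isCompOf h hx]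
  exact .of_adj (h.1 hx) hy hxy

/-! ### Sets closed off by a ball -/

namespace ClosedOff

variable {A A' B S : Set V}

lemma mem_of_joined (h : ClosedOff X B A) (hS : Disjoint S B) {x y : V}
    (hj : Joined X S x y) (hx : x ∈ A) : y ∈ A := by
  obtain ⟨p, hp⟩ := hj
  induction p with
  | nil => exact hx
  | cons hadj q ih =>
    refine ih (h.2 _ hx _ hadj ?_) (fun z hz => hp z (by simp [hz]))
    exact Set.disjoint_left.1 hS (hp _ (by simp))

lemma exists_mem_support (h : ClosedOff X B A) {x y : V} (p : X.Walk x y) (hx : x ∈ A)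
    (hy : y ∉ A) : ∃ z ∈ p.support, z ∈ B := by
  by_contra! hp
  exact hy (h.mem_of_joined (S := Bᶜ) disjoint_compl_left ⟨p, hp⟩ hx)

lemma dist_add_dist_le (hconn : X.Connected) {v : V} {R : ℕ}
    (h : ClosedOff X (cball X v R) A) {x y : V} (hx : x ∈ A) (hy : y ∉ A) :
    X.dist v x + X.dist v y ≤ X.dist x y + 2 * R := by
  classical
  obtain ⟨p, hp⟩ := hconn.exists_walk_length_eq_dist x y
  obtain ⟨z, hz, hzB⟩ := h.exists_mem_support p hx hy
  have h1 := X.dist_le (p.takeUntil z hz)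
  have h2 := X.dist_le (p.dropUntil z hz)
  have h3 : (p.takeUntil z hz).length + (p.dropUntil z hz).length = p.length := by
    rw [← Walk.length_append, Walk.take_spec]
  have h4 : X.dist v x ≤ X.dist v z + X.dist z x := hconn.dist_triangle
  have h5 : X.dist v y ≤ X.dist v z + X.dist z y := hconn.dist_triangle
  rw [X.dist_comm (u := z) (v := x)] at h4
  have h6 : X.dist v z ≤ R := hzB
  omega

lemma lt_dist {v : V} {R : ℕ} (h : ClosedOff X (cball X v R) A) {x : V} (hx : x ∈ A) :
    R < X.dist v x :=
  not_le.1 fun hxR => Set.disjoint_left.1 h.1 hx hxR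

lemma diff (h : ClosedOff X B A) {B' : Set V} (hB : B ⊆ B') : ClosedOff X B' (A \ B') :=
  ⟨Set.disjoint_sdiff_left, fun x hx y hxy hy => ⟨h.2 x hx.1 y hxy fun hyB => hy (hB hyB), hy⟩⟩

lemma sdiff (h : ClosedOff X B A) (h' : ClosedOff X B A') : ClosedOff X B (A \ A') :=
  ⟨h.1.mono_left Set.sdiff_subset, fun x hx y hxy hy => ⟨h.2 x hx.1 y hxy hy, fun hyA =>
    hx.2 (h'.2 y hyA x hxy.symm (Set.disjoint_left.1 h.1 hx.1))⟩⟩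

end ClosedOff

lemma mem_cball_self (v : V) (R : ℕ) : v ∈ cball X v R := by simp [cball]

lemma joined_cball (hconn : X.Connected) {v x : V} {R : ℕ} (hx : x ∈ cball X v R) :
    Joined X (cball X v R) v x := by
  classical
  obtain ⟨p, hp⟩ := hconn.exists_walk_length_eq_dist v x
  refine ⟨p, fun z hz => ?_⟩
  have h1 := X.dist_le (p.takeUntil z hz)
  have h2 := p.length_takeUntil_le_length hz
  have h3 : X.dist v x ≤ R := hx
  show X.dist v z ≤ R
  omega

lemma joined_union (hconn : X.Connected) {v x : V} {R : ℕ} {A : Set V}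
    (h : ClosedOff X (cball X v R) A) (hx : x ∈ A ∪ cball X v R) :
    Joined X (A ∪ cball X v R) v x := by
  obtain ⟨p⟩ := hconn.preconnected x v
  suffices H : ∀ {x y : V} (_ : X.Walk x y), y ∈ cball X v R → x ∈ A ∪ cball X v R →
      ∃ b ∈ cball X v R, Joined X (A ∪ cball X v R) x b by
    obtain ⟨b, hb, hxb⟩ := H p (mem_cball_self v R) hx
    exact ((joined_cball hconn hb).mono Set.subset_union_right).trans hxb.symm
  intro x y p hy hx
  induction p with
  | nil => exact ⟨_, hy, .refl hx⟩
  | @cons a b c hadj q ih =>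
    rcases hx with hx | hx
    · have hb : b ∈ A ∪ cball X v R := by
        by_cases hbB : b ∈ cball X v R
        exacts [.inr hbB, .inl (h.2 _ hx _ hadj hbB)]
      obtain ⟨d, hd, hbd⟩ := ih hy hb
      exact ⟨d, hd, (Joined.of_adj (.inl hx) hb hadj).trans hbd⟩
    · exact ⟨a, hx, .refl (.inr hx)⟩

lemma cball_finite (hconn : X.Connected) (hlf : ∀ v : V, (X.neighborSet v).Finite) (v : V)
    (R : ℕ) : (cball X v R).Finite := by
  induction R with
  | zero =>
    refine (Set.finite_singleton v).subset fun x hx => ?_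
    have : X.dist v x = 0 := Nat.le_zero.1 hx
    exact (hconn.dist_eq_zero_iff.1 this).symm
  | succ R ih =>
    refine (ih.union (ih.biUnion fun x _ => hlf x)).subset fun x hx => ?_
    by_cases hxv : v = x
    · exact .inl (hxv ▸ mem_cball_self v R)
    obtain ⟨p, hp⟩ := hconn.exists_walk_length_eq_dist x v
    cases p with
    | nil => exact absurd rfl hxv
    | @cons _ y _ hadj q =>
      refine .inr (Set.mem_biUnion (x := y) ?_ hadj.symm)
      have h1 := X.dist_le q
      have h2 : X.dist v x ≤ R + 1 := hx
      rw [X.dist_comm] at h1 h2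
      rw [Walk.length_cons] at hp
      show X.dist v y ≤ R
      omega

lemma exists_lt_dist (hconn : X.Connected) (hlf : ∀ v : V, (X.neighborSet v).Finite) (v : V)
    {A : Set V} (hA : A.Infinite) (M : ℕ) : ∃ x ∈ A, M < X.dist v x := by
  obtain ⟨x, hx, hx'⟩ := hA.exists_notMem_finite (cball_finite hconn hlf v M)
  exact ⟨x, hx, not_le.1 hx'⟩

lemma exists_subset_cball {K : Set V} (hK : K.Finite) (v : V) : ∃ R, K ⊆ cball X v R := by
  obtain ⟨R, hR⟩ := (hK.image (X.dist v)).bddAbove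
  exact ⟨R, fun x hx => hR ⟨x, hx, rfl⟩⟩

lemma cball_subset (hconn : X.Connected) {v w : V} {R R' : ℕ} (h : X.dist w v + R ≤ R') :
    cball X v R ⊆ cball X w R' := fun x hx => by
  have h1 : X.dist w x ≤ X.dist w v + X.dist v x := hconn.dist_triangle
  have h2 : X.dist v x ≤ R := hx
  show X.dist w x ≤ R'
  omega

lemma dist_iso (φ : X ≃g X) (u v : V) : X.dist (φ u) (φ v) = X.dist u v := by
  have key : ∀ (ψ : X ≃g X) (u v : V), X.Reachable u v → X.dist (ψ u) (ψ v) ≤ X.dist u v := by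
    intro ψ u v h
    obtain ⟨p, hp⟩ := h.exists_walk_length_eq_dist
    rw [← hp, ← Walk.length_map ψ.toHom p]
    exact X.dist_le _
  by_cases h : X.Reachable u v
  · refine (key φ u v h).antisymm ?_
    have := key φ.symm (φ u) (φ v) (h.map φ.toHom)
    simpa using this
  · rw [dist_eq_zero_of_not_reachable h, dist_eq_zero_of_not_reachable]
    rwa [Iso.reachable_iff]

lemma IsSep.comp {v : V} {R : ℕ} {ι κ : Type} {A : ι → Set V} (h : IsSep X v R A) {f : κ → ι}
    (hf : Function.Injective f) : IsSep X v R (A ∘ f) :=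
  ⟨fun _ => h.infinite _, fun _ => h.closedOff _, fun _ _ hij => h.disjoint _ _ (hf.ne hij)⟩

lemma IsSep.translate (htrans : ∀ u v : V, ∃ φ : X ≃g X, φ u = v) {v : V} {R : ℕ} {ι : Type}
    {A : ι → Set V} (h : IsSep X v R A) (w : V) : ∃ A' : ι → Set V, IsSep X w R A' := by
  obtain ⟨φ, rfl⟩ := htrans v w
  refine ⟨fun i => φ '' A i, fun i => (h.infinite i).image φ.injective.injOn, fun i => ?_,
    fun i j hij => (Set.disjoint_image_iff φ.injective).2 (h.disjoint i j hij)⟩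
  refine ⟨?_, ?_⟩
  · rw [Set.disjoint_left]
    rintro _ ⟨x, hx, rfl⟩ hxB
    refine Set.disjoint_left.1 (h.closedOff i).1 hx ?_
    simpa [cball, dist_iso] using hxB
  · rintro _ ⟨x, hx, rfl⟩ y hxy hy
    obtain ⟨y, rfl⟩ := φ.surjective y
    refine ⟨y, (h.closedOff i).2 x hx y (φ.map_adj_iff.1 hxy) ?_, rfl⟩
    simpa [cball, dist_iso] using hy

/-- All but one set of a translated separating family avoid a given connected set. -/
lemma IsSep.relocate (htrans : ∀ u v : V, ∃ φ : X ≃g X, φ u = v) {v : V} {R : ℕ} {ι : Type}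
    [Nonempty ι] {A : ι → Set V} (h : IsSep X v R A) {w : V} {L : Set V}
    (hL : ∀ x ∈ L, ∀ y ∈ L, Joined X L x y) (hw : Disjoint L (cball X w R)) :
    ∃ (i₀ : ι) (A' : ι → Set V), IsSep X w R A' ∧ ∀ i, i ≠ i₀ → Disjoint (A' i) L := by
  obtain ⟨A', hA'⟩ := h.translate htrans w
  by_cases hmeet : ∃ i, ¬ Disjoint (A' i) L
  · obtain ⟨i₀, hi₀⟩ := hmeet
    refine ⟨i₀, A', hA', fun i hi => Set.disjoint_left.2 fun x hx hxL => ?_⟩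
    obtain ⟨y, hy, hyL⟩ := Set.not_disjoint_iff.1 hi₀
    have := (hA'.closedOff i).mem_of_joined hw (hL x hxL y hyL) hx
    exact Set.disjoint_left.1 (hA'.disjoint i i₀ hi) this hy
  · push Not at hmeet
    exact ⟨Classical.arbitrary ι, A', hA', fun i _ => hmeet i⟩

/-! ### Wide sets -/

/-- Two disjoint sets closed off by a ball cannot be sent upwards to infinity by the same
quasi-isometric embedding into the line. -/
lemma not_unbounded_of_disjoint (hconn : X.Connected) {v : V} {R : ℕ} {A A' Z : Set V}
    (hA : ClosedOff X (cball X v R) A) (hA' : ClosedOff X (cball X v R) A')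
    (hdisj : Disjoint A A') (hZ : A ∪ cball X v R ⊆ Z) (hZ' : A' ∪ cball X v R ⊆ Z)
    {lam c : ℝ} (hlam : 1 ≤ lam) {f : V → ℝ}
    (hf : ∀ x ∈ Z, ∀ y ∈ Z, |f x - f y| ≤ lam * (X.dist x y : ℝ) + c ∧
      (X.dist x y : ℝ) ≤ lam * |f x - f y| + c)
    (hub : ∀ M : ℝ, ∃ x ∈ A, M < f x - f v) (hub' : ∀ M : ℝ, ∃ x ∈ A', M < f x - f v) :
    False := by
  have hvZ : v ∈ Z := hZ (.inr (mem_cball_self v R))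
  have step : ∀ T : ℝ, lam * R + c ≤ T → 0 ≤ T → ∀ A : Set V, ClosedOff X (cball X v R) A →
      A ∪ cball X v R ⊆ Z → (∀ M : ℝ, ∃ x ∈ A, M < f x - f v) →
      ∃ x ∈ A, T < f x - f v ∧ f x - f v ≤ T + (lam + c) := by
    intro T hT hT0 A hA hZ hub
    obtain ⟨x, hx, hxT⟩ := hub T
    obtain ⟨p, hp⟩ := joined_union hconn hA (.inl hx)
    suffices H : ∀ {a b : V} (p : X.Walk a b), (∀ z ∈ p.support, z ∈ A ∪ cball X v R) →
        f a - f v ≤ T → T < f b - f v →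
        ∃ x ∈ A ∪ cball X v R, T < f x - f v ∧ f x - f v ≤ T + (lam + c) by
      obtain ⟨y, hy, h1, h2⟩ := H p hp (by simpa using hT0) hxT
      refine ⟨y, hy.resolve_right fun hyB => ?_, h1, h2⟩
      have h3 := (le_abs_self _).trans (hf y (hZ hy) v hvZ).1
      have h4 : (X.dist y v : ℝ) ≤ R := by
        rw [X.dist_comm]
        exact_mod_cast hyB
      nlinarith
    intro a b p hp ha hb
    induction p with
    | nil => linarith
    | @cons a d b hadj q ih =>
      have haS := hp a (by simp)
      have hdS := hp d (by simp)
      by_cases hd : f d - f v ≤ T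
      · exact ih (fun z hz => hp z (by simp [hz])) hd hb
      · refine ⟨d, hdS, not_le.1 hd, ?_⟩
        have h3 := (le_abs_self _).trans (hf d (hZ hdS) a (hZ haS)).1
        rw [dist_eq_one_iff_adj.2 hadj.symm] at h3
        push_cast at h3
        linarith
  set D : ℝ := lam * (lam + c) + c with hD
  obtain ⟨T, hT1, hT2, hT3⟩ : ∃ T : ℝ, lam * R + c ≤ T ∧ 0 ≤ T ∧ lam * (D + R + 1) + c ≤ T :=
    ⟨_, (le_max_left _ _).trans (le_max_left _ _), le_max_right _ _,
      (le_max_right _ _).trans (le_max_left _ _)⟩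
  obtain ⟨x, hx, hx1, hx2⟩ := step T hT1 hT2 A hA hZ hub
  obtain ⟨y, hy, hy1, hy2⟩ := step T hT1 hT2 A' hA' hZ' hub'
  have hxZ := hZ (.inl hx)
  have hyZ := hZ' (.inl hy)
  have h1 : |f x - f y| ≤ lam + c := abs_le.2 ⟨by linarith, by linarith⟩
  have h2 : (X.dist x y : ℝ) ≤ D := by
    refine (hf x hxZ y hyZ).2.trans ?_
    nlinarith
  have h3 := hA.dist_add_dist_le hconn hx (Set.disjoint_right.1 hdisj hy)
  have h4 := hA'.lt_dist hy
  have h5 : X.dist v x ≤ X.dist x y + R := by omega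
  have h6 : (X.dist v x : ℝ) ≤ X.dist x y + R := by exact_mod_cast h5
  have h7 := (le_abs_self _).trans (hf x hxZ v hvZ).1
  rw [X.dist_comm] at h7
  nlinarith

lemma wide_of_three (hconn : X.Connected) (hlf : ∀ v : V, (X.neighborSet v).Finite) {v : V}
    {R : ℕ} {A : Fin 3 → Set V} (hA : IsSep X v R A) {Z : Set V}
    (hZ : ∀ i, A i ∪ cball X v R ⊆ Z) : Wide X Z := by
  classical
  rintro ⟨lam, c, g, hlam, hc, hg⟩
  set f : V → ℝ := fun x => if h : x ∈ Z then g ⟨x, h⟩ else 0 with hfdef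
  have hf : ∀ x ∈ Z, ∀ y ∈ Z, |f x - f y| ≤ lam * (X.dist x y : ℝ) + c ∧
      (X.dist x y : ℝ) ≤ lam * |f x - f y| + c := by
    intro x hx y hy
    simpa [hfdef, hx, hy] using hg ⟨x, hx⟩ ⟨y, hy⟩
  have hvZ : v ∈ Z := hZ 0 (.inr (mem_cball_self v R))
  have hubd : ∀ i, ∀ M : ℝ, ∃ x ∈ A i, M < |f x - f v| := by
    intro i M
    obtain ⟨N, hN⟩ := exists_nat_gt (lam * M + c)
    obtain ⟨x, hx, hxN⟩ := exists_lt_dist hconn hlf v (hA.infinite i) N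
    refine ⟨x, hx, not_le.1 fun hM => ?_⟩
    have h1 := (hf x (hZ i (.inl hx)) v hvZ).2
    rw [X.dist_comm] at h1
    have h2 : (N : ℝ) < X.dist v x := by exact_mod_cast hxN
    nlinarith
  have hsign : ∀ i, (∀ M : ℝ, ∃ x ∈ A i, M < f x - f v) ∨
      ∀ M : ℝ, ∃ x ∈ A i, M < (-f) x - (-f) v := by
    intro i
    by_contra! h
    obtain ⟨⟨M, hM⟩, M', hM'⟩ := h
    obtain ⟨x, hx, hxM⟩ := hubd i (max M M')
    have h1 := hM x hx
    have h2 := hM' x hx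
    simp only [Pi.neg_apply] at h2
    exact absurd hxM (not_lt.2 (abs_le.2 ⟨by linarith [le_max_right M M'],
      by linarith [le_max_left M M']⟩))
  have pos : ∀ i j, i ≠ j → (∀ M : ℝ, ∃ x ∈ A i, M < f x - f v) →
      ¬ ∀ M : ℝ, ∃ x ∈ A j, M < f x - f v := fun i j hij hi hj =>
    not_unbounded_of_disjoint hconn (hA.closedOff i) (hA.closedOff j) (hA.disjoint i j hij)
      (hZ i) (hZ j) hlam hf hi hj
  have neg : ∀ i j, i ≠ j → (∀ M : ℝ, ∃ x ∈ A i, M < (-f) x - (-f) v) →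
      ¬ ∀ M : ℝ, ∃ x ∈ A j, M < (-f) x - (-f) v := fun i j hij hi hj => by
    refine not_unbounded_of_disjoint hconn (hA.closedOff i) (hA.closedOff j)
      (hA.disjoint i j hij) (hZ i) (hZ j) hlam (c := c) (f := -f) (fun x hx y hy => ?_) hi hj
    have h : |(-f) x - (-f) y| = |f x - f y| := by
      rw [abs_sub_comm, Pi.neg_apply, Pi.neg_apply, neg_sub_neg]
    simpa only [h] using hf x hx y hy
  rcases hsign 0 with h0 | h0 <;> rcases hsign 1 with h1 | h1 <;> rcases hsign 2 with h2 | h2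
  exacts [pos 0 1 (by decide) h0 h1, pos 0 1 (by decide) h0 h1, pos 0 2 (by decide) h0 h2,
    neg 1 2 (by decide) h1 h2, pos 1 2 (by decide) h1 h2, neg 0 2 (by decide) h0 h2,
    neg 0 1 (by decide) h0 h1, neg 0 1 (by decide) h0 h1]

lemma narrow_mono {Z Z' : Set V} (h : Z ⊆ Z') (hZ : Narrow X Z') : Narrow X Z := by
  obtain ⟨lam, c, f, hlam, hc, hf⟩ := hZ
  exact ⟨lam, c, fun x => f ⟨x, h x.2⟩, hlam, hc, fun x y => hf ⟨x, h x.2⟩ ⟨y, h y.2⟩⟩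

/-! ### Geodesic rays and quasi-geodesics -/

lemma exists_ray (hconn : X.Connected) (hlf : ∀ v : V, (X.neighborSet v).Finite) (v : V)
    {A : Set V} (hA : A.Infinite) :
    ∃ γ : ℕ → V, γ 0 = v ∧ (∀ n, X.Adj (γ n) (γ (n + 1))) ∧ (∀ n, X.dist v (γ n) = n) ∧
      ∀ n, ∃ y ∈ A, X.dist v y = n + X.dist (γ n) y := by
  set E : V → Set V := fun x => {y | y ∈ A ∧ X.dist v y = X.dist v x + X.dist x y} with hE
  have step : ∀ x : {x // (E x).Infinite}, ∃ x' : {x // (E x).Infinite},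
      X.Adj x.1 x'.1 ∧ X.dist v x'.1 = X.dist v x.1 + 1 := by
    rintro ⟨x, hx⟩
    by_contra! hno
    refine hx (((Set.finite_singleton x).union ((hlf x).biUnion
      (t := fun x' => {y | y ∈ E x' ∧ X.dist v x' = X.dist v x + 1}) fun x' hx' => ?_)).subset ?_)
    · by_contra hinf
      have hinf' : (E x').Infinite := Set.Infinite.mono (fun y hy => hy.1) hinf
      obtain ⟨y, hy⟩ := (show Set.Infinite _ from hinf).nonempty
      exact hno ⟨x', hinf'⟩ hx' hy.2
    · rintro y ⟨hyA, hy⟩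
      by_cases hxy : x = y
      · exact .inl hxy.symm
      obtain ⟨p, hp⟩ := hconn.exists_walk_length_eq_dist x y
      cases p with
      | nil => exact absurd rfl hxy
      | @cons _ x' _ hadj q =>
        rw [Walk.length_cons] at hp
        have h1 := X.dist_le q
        have h2 : X.dist v y ≤ X.dist v x' + X.dist x' y := hconn.dist_triangle
        have h3 : X.dist v x' ≤ X.dist v x + X.dist x x' := hconn.dist_triangle
        rw [dist_eq_one_iff_adj.2 hadj] at h3
        exact .inr (Set.mem_biUnion (x := x') hadj ⟨⟨hyA, by omega⟩, by omega⟩)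
  choose next hnext using step
  have hv : (E v).Infinite := by
    have : E v = A := by ext y; simp [hE]
    rwa [this]
  set γ : ℕ → {x // (E x).Infinite} := fun n => Nat.rec ⟨v, hv⟩ (fun _ x => next x) n
  have hdist : ∀ n, X.dist v (γ n).1 = n := by
    intro n
    induction n with
    | zero => exact X.dist_self
    | succ n ih => exact (hnext (γ n)).2.trans (congrArg (· + 1) ih)
  refine ⟨fun n => (γ n).1, rfl, fun n => (hnext (γ n)).1, hdist, fun n => ?_⟩
  obtain ⟨y, hyA, hy⟩ := (γ n).2.nonempty
  exact ⟨y, hyA, by rw [hy, hdist]⟩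

lemma exists_ray_mem (hconn : X.Connected) (hlf : ∀ v : V, (X.neighborSet v).Finite) {v : V}
    {R : ℕ} {A : Set V} (hA : A.Infinite) (hcl : ClosedOff X (cball X v R) A) :
    ∃ γ : ℕ → V, γ 0 = v ∧ (∀ n, X.Adj (γ n) (γ (n + 1))) ∧ (∀ n, X.dist v (γ n) = n) ∧
      ∀ n, R < n → γ n ∈ A := by
  obtain ⟨γ, h0, hadj, hdist, hγ⟩ := exists_ray hconn hlf v hA
  refine ⟨γ, h0, hadj, hdist, fun n hn => ?_⟩
  obtain ⟨y, hy, hvy⟩ := hγ n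
  by_contra hnA
  have h1 := hcl.dist_add_dist_le hconn hy hnA
  rw [hdist, X.dist_comm (u := y)] at h1
  omega

lemma exists_closed_walk (hconn : X.Connected) (v : V) {S : Set V} (hS : S.Finite) :
    ∃ p : X.Walk v v, ∀ x ∈ S, x ∈ p.support := by
  induction S, hS using Set.Finite.induction_on with
  | empty => exact ⟨.nil, by simp⟩
  | @insert a S _ _ ih =>
    obtain ⟨p, hp⟩ := ih
    obtain ⟨q⟩ := hconn.preconnected v a
    refine ⟨p.append (q.append q.reverse), fun x hx => ?_⟩
    rcases hx with rfl | hx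
    · simp [Walk.mem_support_append_iff]
    · simp [Walk.mem_support_append_iff, hp x hx]

lemma dist_le_of_path {ρ : ℤ → V} (hconn : X.Connected) (hρ : ∀ n, X.Adj (ρ n) (ρ (n + 1)))
    (s t : ℤ) : (X.dist (ρ s) (ρ t) : ℝ) ≤ |(s : ℝ) - t| := by
  have key : ∀ (s : ℤ) (k : ℕ), X.dist (ρ s) (ρ (s + k)) ≤ k := by
    intro s k
    induction k with
    | zero => simp
    | succ k ih =>
      have h1 : X.dist (ρ s) (ρ (s + k + 1)) ≤ X.dist (ρ s) (ρ (s + k)) +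
        X.dist (ρ (s + k)) (ρ (s + k + 1)) := hconn.dist_triangle
      rw [dist_eq_one_iff_adj.2 (hρ (s + k))] at h1
      push_cast
      rw [← add_assoc]
      omega
  wlog h : s ≤ t generalizing s t
  · rw [X.dist_comm, abs_sub_comm]
    exact this t s (by omega)
  obtain ⟨k, rfl⟩ := Int.le.dest h
  have : (X.dist (ρ s) (ρ (s + k)) : ℝ) ≤ k := by exact_mod_cast key s k
  simpa using this

/-- If the graph is a neighbourhood of a quasi-geodesic then it is narrow. -/
lemma narrow_univ (hconn : X.Connected) {ρ : ℤ → V} (hρ : IsBiQuasiGeodesic X ρ) {D : ℕ}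
    (hD : ∀ x, ∃ n, X.dist x (ρ n) ≤ D) : Narrow X Set.univ := by
  obtain ⟨lam, c, hlam, hc, hadj, hqg⟩ := hρ
  choose τ hτ using hD
  refine ⟨lam, lam * (2 * D + c) + 2 * D, fun x => τ x.1, hlam, by positivity, ?_⟩
  rintro ⟨x, -⟩ ⟨y, -⟩
  have h1 : X.dist x y ≤ X.dist x (ρ (τ x)) + X.dist (ρ (τ x)) y := hconn.dist_triangle
  have h2 : X.dist (ρ (τ x)) y ≤ X.dist (ρ (τ x)) (ρ (τ y)) + X.dist (ρ (τ y)) y :=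
    hconn.dist_triangle
  have h3 : X.dist (ρ (τ x)) (ρ (τ y)) ≤ X.dist (ρ (τ x)) x + X.dist x (ρ (τ y)) :=
    hconn.dist_triangle
  have h4 : X.dist x (ρ (τ y)) ≤ X.dist x y + X.dist y (ρ (τ y)) := hconn.dist_triangle
  rw [X.dist_comm (u := ρ (τ y))] at h2
  rw [X.dist_comm (u := ρ (τ x)) (v := x)] at h3
  have hx := hτ x
  have hy := hτ y
  have h5 : X.dist x y ≤ X.dist (ρ (τ x)) (ρ (τ y)) + 2 * D := by omega
  have h6 : X.dist (ρ (τ x)) (ρ (τ y)) ≤ X.dist x y + 2 * D := by omega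
  have h7 : (X.dist x y : ℝ) ≤ X.dist (ρ (τ x)) (ρ (τ y)) + 2 * D := by exact_mod_cast h5
  have h8 : (X.dist (ρ (τ x)) (ρ (τ y)) : ℝ) ≤ X.dist x y + 2 * D := by exact_mod_cast h6
  have h9 := dist_le_of_path hconn hadj (τ x) (τ y)
  have h10 : |(τ x : ℝ) - τ y| ≤ lam * (X.dist (ρ (τ x)) (ρ (τ y)) + c) := by
    have := hqg (τ x) (τ y)
    rw [sub_le_iff_le_add, div_le_iff₀ (by linarith)] at this
    linarith
  have hD0 : (0 : ℝ) ≤ D := by positivity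
  constructor
  · nlinarith [mul_le_mul_of_nonneg_left h8 (show 0 ≤ lam by linarith)]
  · nlinarith [abs_nonneg ((τ x : ℝ) - τ y)]

/-- A bi-infinite quasi-geodesic joining two disjoint sets closed off by a ball, and covering
this ball. -/
lemma exists_quasiGeodesic (hconn : X.Connected) (hlf : ∀ v : V, (X.neighborSet v).Finite)
    {v : V} {R : ℕ} {A : Fin 2 → Set V} (hA : IsSep X v R A) :
    ∃ ρ : ℤ → V, IsBiQuasiGeodesic X ρ ∧ cball X v R ⊆ Set.range ρ ∧
      (∀ i, (A i ∩ Set.range ρ).Infinite) ∧ ∃ M, ∀ n, ρ n ∈ A 0 ∪ A 1 ∪ cball X v M := by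
  obtain ⟨a, ha0, haadj, hadist, haA⟩ := exists_ray_mem hconn hlf (hA.infinite 0) (hA.closedOff 0)
  obtain ⟨b, hb0, hbadj, hbdist, hbA⟩ := exists_ray_mem hconn hlf (hA.infinite 1) (hA.closedOff 1)
  obtain ⟨q, hq⟩ := exists_closed_walk hconn v (cball_finite hconn hlf v R)
  obtain ⟨m, hm⟩ : ∃ m, q.length = m := ⟨_, rfl⟩
  set ρ : ℤ → V := fun n => if n ≤ 0 then a (-n).toNat else
    if n ≤ m then q.getVert n.toNat else b (n - m).toNat with hρdef
  have ρneg : ∀ k : ℕ, ρ (-k) = a k := by intro k; simp [hρdef]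
  have ρpos : ∀ k : ℕ, ρ (m + k) = b k := by
    intro k
    by_cases h0 : (m : ℤ) + k ≤ 0
    · obtain ⟨rfl, rfl⟩ : m = 0 ∧ k = 0 := by omega
      simp [hρdef, ha0, hb0]
    by_cases h1 : (m : ℤ) + k ≤ m
    · obtain rfl : k = 0 := by omega
      simp only [hρdef, if_neg h0, if_pos h1, hb0]
      simp [← hm]
    · simp only [hρdef, if_neg h0, if_neg h1]
      simp
  have ρmid : ∀ k : ℕ, k ≤ m → ρ k = q.getVert k := by
    intro k hk
    by_cases h0 : (k : ℤ) ≤ 0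
    · obtain rfl : k = 0 := by omega
      simp [hρdef, ha0]
    · simp [hρdef, if_neg h0, hk]
  have cases3 : ∀ n : ℤ, (∃ k : ℕ, n = -k) ∨ (∃ k : ℕ, k < m ∧ n = k) ∨ ∃ k : ℕ, n = m + k := by
    intro n
    rcases le_or_gt n 0 with h | h
    · exact .inl ⟨(-n).toNat, by omega⟩
    rcases lt_or_ge n m with h' | h'
    · exact .inr (.inl ⟨n.toNat, by omega, by omega⟩)
    · exact .inr (.inr ⟨(n - m).toNat, by omega⟩)
  have hadj : ∀ n, X.Adj (ρ n) (ρ (n + 1)) := by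
    intro n
    rcases cases3 n with ⟨k, rfl⟩ | ⟨k, hk, rfl⟩ | ⟨k, rfl⟩
    · rcases k with _ | k
      · by_cases hm0 : m = 0
        · have h1 := ρpos 0
          have h2 := ρpos 1
          subst hm0
          simp only [Nat.cast_zero, Nat.cast_one, zero_add, neg_zero] at h1 h2 ⊢
          rw [h1, h2]
          exact hbadj 0
        · have h1 := ρmid 0 (by omega)
          have h2 := ρmid 1 (by omega)
          simp only [Nat.cast_zero, Nat.cast_one, zero_add, neg_zero] at h1 h2 ⊢
          rw [h1, h2]
          exact q.adj_getVert_succ (by omega)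
      · rw [show (-((k + 1 : ℕ) : ℤ) + 1) = -(k : ℤ) by push_cast; ring, ρneg, ρneg]
        exact (haadj k).symm
    · rw [show ((k : ℤ) + 1) = ((k + 1 : ℕ) : ℤ) by push_cast; rfl, ρmid k hk.le, ρmid _ hk]
      exact q.adj_getVert_succ (by omega)
    · rw [show ((m : ℤ) + k + 1) = m + ((k + 1 : ℕ) : ℤ) by push_cast; ring, ρpos, ρpos]
      exact hbadj k
  have hmid : ∀ k : ℕ, k ≤ m → X.dist v (ρ k) ≤ m := by
    intro k hk
    rw [ρmid k hk]
    refine (X.dist_le (q.take k)).trans ?_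
    rw [Walk.take_length]
    omega
  have hlow : ∀ s t : ℤ, s ≤ t → t - s ≤ X.dist (ρ s) (ρ t) + (2 * R + 2 * m : ℕ) := by
    intro s t hst
    have h1 : X.dist v (ρ s) ≤ X.dist v (ρ t) + X.dist (ρ t) (ρ s) := hconn.dist_triangle
    have h2 : X.dist v (ρ t) ≤ X.dist v (ρ s) + X.dist (ρ s) (ρ t) := hconn.dist_triangle
    rw [X.dist_comm (u := ρ t)] at h1
    rcases cases3 s with ⟨k, rfl⟩ | ⟨k, hk, rfl⟩ | ⟨k, rfl⟩ <;>
    rcases cases3 t with ⟨l, rfl⟩ | ⟨l, hl, rfl⟩ | ⟨l, rfl⟩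
    · rw [ρneg, ρneg] at *
      rw [hadist, hadist] at *
      omega
    · have := hmid l hl.le
      rw [ρneg] at *
      rw [hadist] at *
      omega
    · rw [ρneg, ρpos] at *
      have h3 : R < k → R < l → X.dist v (a k) + X.dist v (b l) ≤ X.dist (a k) (b l) + 2 * R :=
        fun hk hl => (hA.closedOff 0).dist_add_dist_le hconn (haA k hk)
          (Set.disjoint_right.1 (hA.disjoint 0 1 (by decide)) (hbA l hl))
      rw [hadist, hbdist] at *
      omega
    all_goals first | omega | skip
    · have := hmid k hk.le
      rw [ρpos] at *
      rw [hbdist] at *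
      omega
    · rw [ρpos, ρpos] at *
      rw [hbdist, hbdist] at *
      omega
  refine ⟨ρ, ⟨1, (2 * R + 2 * m : ℕ), le_rfl, by positivity, hadj, fun s t => ?_⟩, ?_, ?_, ?_⟩
  · rw [div_one, sub_le_iff_le_add]
    rcases le_total s t with h | h
    · rw [abs_sub_comm, abs_of_nonneg (sub_nonneg.2 (by exact_mod_cast h))]
      exact_mod_cast hlow s t h
    · rw [abs_of_nonneg (sub_nonneg.2 (by exact_mod_cast h)), X.dist_comm]
      exact_mod_cast hlow t s h
  · intro x hx
    obtain ⟨k, rfl, hk⟩ := Walk.mem_support_iff_exists_getVert.1 (hq x hx)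
    exact ⟨k, ρmid k (hm ▸ hk)⟩
  · have inf : ∀ (γ : ℕ → V) (i : Fin 2), (∀ n, X.dist v (γ n) = n) → (∀ n, R < n → γ n ∈ A i) →
        (∀ n, γ n ∈ Set.range ρ) → (A i ∩ Set.range ρ).Infinite := by
      intro γ i h1 h2 h3
      refine Set.infinite_of_injective_forall_mem (f := fun n => γ (R + 1 + n)) ?_ fun n =>
        ⟨h2 _ (by omega), h3 _⟩
      intro k l hkl
      have := congrArg (X.dist v) hkl
      simp only [h1] at this
      omega
    intro i
    fin_cases i
    · exact inf a 0 hadist haA fun n => ⟨_, ρneg n⟩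
    · exact inf b 1 hbdist hbA fun n => ⟨_, ρpos n⟩
  · refine ⟨R + m, fun n => ?_⟩
    rcases cases3 n with ⟨k, rfl⟩ | ⟨k, hk, rfl⟩ | ⟨k, rfl⟩
    · rw [ρneg]
      by_cases hk : R < k
      · exact .inl (.inl (haA k hk))
      · exact .inr (show X.dist v (a k) ≤ _ by rw [hadist]; omega)
    · exact .inr ((hmid k hk.le).trans (by omega))
    · rw [ρpos]
      by_cases hk : R < k
      · exact .inl (.inr (hbA k hk))
      · exact .inr (show X.dist v (b k) ≤ _ by rw [hbdist]; omega)

lemma joined_range {ρ : ℤ → V} (hρ : ∀ n, X.Adj (ρ n) (ρ (n + 1))) (s t : ℤ) :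
    Joined X (Set.range ρ) (ρ s) (ρ t) := by
  have key : ∀ t : ℤ, Joined X (Set.range ρ) (ρ 0) (ρ t) := by
    intro t
    induction t using Int.induction_on with
    | zero => exact .refl ⟨0, rfl⟩
    | succ k ih => exact ih.trans (.of_adj ⟨_, rfl⟩ ⟨_, rfl⟩ (hρ k))
    | pred k ih =>
      refine ih.trans (.of_adj ⟨_, rfl⟩ ⟨_, rfl⟩ ?_)
      simpa using (hρ (-k - 1)).symm
  exact (key s).symm.trans (key t)

lemma joined_gnbhd (hconn : X.Connected) {ρ : ℤ → V} (hρ : ∀ n, X.Adj (ρ n) (ρ (n + 1)))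
    {σ : ℝ} (hσ : 0 < σ) {x y : V} (hx : x ∈ gnbhd X (Set.range ρ) σ)
    (hy : y ∈ gnbhd X (Set.range ρ) σ) : Joined X (gnbhd X (Set.range ρ) σ) x y := by
  have key : ∀ x ∈ gnbhd X (Set.range ρ) σ, ∃ n, Joined X (gnbhd X (Set.range ρ) σ) (ρ n) x := by
    rintro x ⟨_, ⟨n, rfl⟩, hn⟩
    have hx : x ∈ cball X (ρ n) ⌊σ⌋₊ := by
      rw [X.dist_comm] at hn
      exact Nat.le_floor hn
    refine ⟨n, (joined_cball hconn hx).mono fun z hz => ⟨ρ n, ⟨n, rfl⟩, ?_⟩⟩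
    rw [X.dist_comm]
    exact (Nat.cast_le.2 hz).trans (Nat.floor_le hσ.le)
  obtain ⟨s, hs⟩ := key x hx
  obtain ⟨t, ht⟩ := key y hy
  refine (hs.symm.trans ((joined_range hρ s t).mono fun z hz => ⟨z, hz, ?_⟩)).trans ht
  simpa using hσ.le

/-! ### Increasing the number of ends -/

lemma union_subset_of_closedOff (hconn : X.Connected) {v x : V} {R : ℕ} {A A' : Set V}
    (hA : ClosedOff X (cball X v R) A) (hx : x ∈ A) (hA' : ClosedOff X (cball X x R) A')
    (hA'v : Disjoint A' (cball X v R)) (hdisj : Disjoint (cball X v R) (cball X x R)) :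
    A' ∪ cball X x R ⊆ A := fun _ hy =>
  hA.mem_of_joined (hA'v.union_left hdisj.symm) (joined_union hconn hA' hy) hx

lemma exists_isSep_three (hconn : X.Connected) (hlf : ∀ v : V, (X.neighborSet v).Finite)
    (htrans : ∀ u v : V, ∃ φ : X ≃g X, φ u = v) {σ : ℝ} (hubq : UBQ X σ) {v : V} {R : ℕ}
    {A : Fin 2 → Set V} (hA : IsSep X v R A) :
    ∃ (R' : ℕ) (A' : Fin 3 → Set V), IsSep X v R' A' := by
  obtain ⟨ρ, hρ, -, hinf, -⟩ := exists_quasiGeodesic hconn hlf hA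
  have hadj : ∀ n, X.Adj (ρ n) (ρ (n + 1)) := by
    obtain ⟨_, _, _, _, h, _⟩ := hρ
    exact h
  obtain ⟨x, hx⟩ : ∃ x, ∀ n, R < X.dist x (ρ n) := by
    by_contra! h
    obtain ⟨U, -, -, -, -, hU, -⟩ := hubq ρ hρ
    exact hU (narrow_mono (Set.subset_univ U) (narrow_univ hconn hρ h))
  have hdisj : Disjoint (Set.range ρ) (cball X x R) := by
    rw [Set.disjoint_left]
    rintro _ ⟨n, rfl⟩ hn
    exact absurd (hx n) (not_lt.2 hn)
  obtain ⟨i₀, A', hA', hL⟩ := hA.relocate htrans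
    (by rintro _ ⟨s, rfl⟩ _ ⟨t, rfl⟩; exact joined_range hadj s t) hdisj
  obtain ⟨i, hi⟩ := exists_ne i₀
  set B := cball X v (X.dist v x + R)
  have hBfin : B.Finite := cball_finite hconn hlf _ _
  have hvB : cball X v R ⊆ B := cball_subset hconn (by simp)
  have hxB : cball X x R ⊆ B := cball_subset hconn le_rfl
  have hC : ClosedOff X B (A' i \ B) := (hA'.closedOff i).diff hxB
  have hinf' : ∀ j, ((A j \ B) \ (A' i \ B)).Infinite := fun j =>
    ((hinf j).sdiff hBfin).mono fun y hy =>
      ⟨⟨hy.1.1, hy.2⟩, fun hy' => Set.disjoint_left.1 (hL i hi) hy'.1 hy.1.2⟩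
  have hcl : ∀ j, ClosedOff X B ((A j \ B) \ (A' i \ B)) := fun j =>
    ((hA.closedOff j).diff hvB).sdiff hC
  have h01 : Disjoint ((A 0 \ B) \ (A' i \ B)) ((A 1 \ B) \ (A' i \ B)) :=
    (hA.disjoint 0 1 (by decide)).mono (fun y hy => hy.1.1) (fun y hy => hy.1.1)
  have h2 : ∀ j, Disjoint ((A j \ B) \ (A' i \ B)) (A' i \ B) := fun j =>
    Set.disjoint_sdiff_left
  refine ⟨X.dist v x + R, ![(A 0 \ B) \ (A' i \ B), (A 1 \ B) \ (A' i \ B), A' i \ B], ?_, ?_, ?_⟩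
  · intro j
    fin_cases j
    exacts [hinf' 0, hinf' 1, (hA'.infinite i).sdiff hBfin]
  · intro j
    fin_cases j
    exacts [hcl 0, hcl 1, hC]
  · intro j k hjk
    fin_cases j <;> fin_cases k
    exacts [absurd rfl hjk, h01, h2 0, h01.symm, absurd rfl hjk, h2 1, (h2 0).symm, (h2 1).symm,
      absurd rfl hjk]

lemma IsSep.exists_double (hconn : X.Connected) (hlf : ∀ v : V, (X.neighborSet v).Finite)
    (htrans : ∀ u v : V, ∃ φ : X ≃g X, φ u = v) {v : V} {R n k : ℕ}
    {A : Fin n → Set V} (hA : IsSep X v R A) (hn : 0 < n) (hk : k ≤ 2 * (n - 1)) :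
    ∃ (R' : ℕ) (A' : Fin k → Set V), IsSep X v R' A' := by
  have : Nonempty (Fin n) := ⟨⟨0, hn⟩⟩
  let i : Fin n := ⟨0, hn⟩
  obtain ⟨x, hx, hxR⟩ := exists_lt_dist hconn hlf v (hA.infinite i) (2 * R)
  have hdisj : Disjoint (cball X v R) (cball X x R) := by
    refine Set.disjoint_left.2 fun y hy hy' => ?_
    have h1 : X.dist v x ≤ X.dist v y + X.dist y x := hconn.dist_triangle
    have h2 : X.dist v y ≤ R := hy
    have h3 : X.dist x y ≤ R := hy'
    rw [X.dist_comm] at h3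
    omega
  obtain ⟨j, A', hA', hL⟩ := hA.relocate htrans
    (fun y hy z hz => (joined_cball hconn hy).symm.trans (joined_cball hconn hz)) hdisj
  set B := cball X v (X.dist v x + R)
  have hBfin : B.Finite := cball_finite hconn hlf _ _
  have hvB : cball X v R ⊆ B := cball_subset hconn (by simp)
  have hxB : cball X x R ⊆ B := cball_subset hconn le_rfl
  have hsub : ∀ l, l ≠ j → A' l ⊆ A i := fun l hl => Set.subset_union_left.trans
    (union_subset_of_closedOff hconn (hA.closedOff i) hx (hA'.closedOff l) (hL l hl) hdisj)
  have hsep : IsSep X v (X.dist v x + R) (ι := {l : Fin n // l ≠ i} ⊕ {l : Fin n // l ≠ j})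
      (Sum.elim (fun l => A l \ B) (fun l => A' l \ B)) := by
    have hmix : ∀ (l : {l : Fin n // l ≠ i}) (l' : {l : Fin n // l ≠ j}),
        Disjoint (A l \ B) (A' l' \ B) := fun l l' =>
      (hA.disjoint l i l.2).mono Set.sdiff_subset (Set.sdiff_subset.trans (hsub l' l'.2))
    refine ⟨?_, ?_, ?_⟩
    · rintro (l | l)
      exacts [(hA.infinite l).sdiff hBfin, (hA'.infinite l).sdiff hBfin]
    · rintro (l | l)
      exacts [(hA.closedOff l).diff hvB, (hA'.closedOff l).diff hxB]
    · rintro (l | l) (l' | l') hne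
      · exact (hA.disjoint l l' fun h => hne (by rw [Subtype.ext h])).mono Set.sdiff_subset
          Set.sdiff_subset
      · exact hmix l l'
      · exact (hmix l' l).symm
      · exact (hA'.disjoint l l' fun h => hne (by rw [Subtype.ext h])).mono Set.sdiff_subset
          Set.sdiff_subset
  obtain ⟨e⟩ : Nonempty (Fin k ↪ {l : Fin n // l ≠ i} ⊕ {l : Fin n // l ≠ j}) := by
    refine Function.Embedding.nonempty_of_card_le ?_
    rw [Fintype.card_sum, Fintype.card_subtype_compl, Fintype.card_subtype_compl]
    simp only [Fintype.card_fin, Fintype.card_subtype_eq]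
    omega
  exact ⟨_, _, hsep.comp e.injective⟩

/-! ### Many ends yield many wide components -/

lemma not_isSep_five (hconn : X.Connected) (hlf : ∀ v : V, (X.neighborSet v).Finite)
    (htrans : ∀ u v : V, ∃ φ : X ≃g X, φ u = v) {σ : ℝ} (hσ : 0 < σ) (hubq : UBQ X σ) {v : V}
    {R : ℕ} {A : Fin 5 → Set V} (hA : IsSep X v R A) : False := by
  obtain ⟨ρ, hρ, hcov, -, M, hM⟩ := exists_quasiGeodesic hconn hlf
    (hA.comp (Fin.castLE_injective (show 2 ≤ 5 by decide)))
  have hadj : ∀ n, X.Adj (ρ n) (ρ (n + 1)) := by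
    obtain ⟨_, _, _, _, h, _⟩ := hρ
    exact h
  set L := gnbhd X (Set.range ρ) σ
  have hvL : cball X v R ⊆ L := fun x hx => ⟨x, hcov hx, by simpa using hσ.le⟩
  have key : ∀ i : Fin 5, 2 ≤ i → ∃ U, IsCompOf X U Lᶜ ∧ Wide X U ∧ U ⊆ A i := by
    intro i hi
    obtain ⟨N, hN⟩ := exists_nat_gt σ
    obtain ⟨x, hx, hxN⟩ := exists_lt_dist hconn hlf v (hA.infinite i) (M + 2 * R + N)
    have hfar : ∀ n, R + N < X.dist x (ρ n) := by
      intro n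
      rcases hM n with hn | hn
      · have hn' : ρ n ∉ A i := by
          rcases hn with hn | hn
          · exact Set.disjoint_left.1 (hA.disjoint 0 i (by rintro rfl; simp at hi)) hn
          · exact Set.disjoint_left.1 (hA.disjoint 1 i (by rintro rfl; simp at hi)) hn
        have h1 := (hA.closedOff i).dist_add_dist_le hconn hx hn'
        have h2 : R < X.dist v (ρ n) := by
          rcases hn with hn | hn
          exacts [(hA.closedOff 0).lt_dist hn, (hA.closedOff 1).lt_dist hn]
        omega
      · have h1 : X.dist v x ≤ X.dist v (ρ n) + X.dist (ρ n) x := hconn.dist_triangle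
        have h2 : X.dist v (ρ n) ≤ M := hn
        rw [X.dist_comm (u := ρ n)] at h1
        omega
    have hdisj : Disjoint L (cball X x R) := by
      rw [Set.disjoint_left]
      rintro y ⟨_, ⟨n, rfl⟩, hy⟩ hyx
      have h1 : X.dist x (ρ n) ≤ X.dist x y + X.dist y (ρ n) := hconn.dist_triangle
      have h2 : X.dist x y ≤ R := hyx
      have h3 : X.dist y (ρ n) < N := by exact_mod_cast hy.trans_lt hN
      have h4 := hfar n
      omega
    obtain ⟨i₀, A', hA', hL⟩ := hA.relocate htrans
      (fun y hy z hz => joined_gnbhd hconn hadj hσ hy hz) hdisj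
    have hxL : x ∈ Lᶜ := Set.disjoint_right.1 hdisj (mem_cball_self x R)
    refine ⟨{y | Joined X Lᶜ x y}, isCompOf_joined hxL, ?_, fun y hy =>
      (hA.closedOff i).mem_of_joined (disjoint_compl_left.mono_right hvL) hy hx⟩
    have hsub : ∀ j, j ≠ i₀ → A' j ∪ cball X x R ⊆ {y | Joined X Lᶜ x y} := fun j hj y hy =>
      (joined_union hconn (hA'.closedOff j) hy).mono <| Set.subset_compl_iff_disjoint_right.2
        ((hL j hj).union_left hdisj.symm)
    obtain ⟨e, he, he'⟩ : ∃ e : Fin 3 → Fin 5, Function.Injective e ∧ ∀ j, e j ≠ i₀ :=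
      ⟨fun j => i₀.succAbove (j.castSucc), fun j k h => by simpa using h,
        fun j => i₀.succAbove_ne _⟩
    exact wide_of_three hconn hlf (hA'.comp he) fun j => hsub _ (he' j)
  obtain ⟨U₁, U₂, -, -, -, -, -, hU⟩ := hubq ρ hρ
  obtain ⟨W₂, hc₂, hw₂, hs₂⟩ := key 2 (by decide)
  obtain ⟨W₃, hc₃, hw₃, hs₃⟩ := key 3 (by decide)
  obtain ⟨W₄, hc₄, hw₄, hs₄⟩ := key 4 (by decide)
  have ne : ∀ i j : Fin 5, i ≠ j → ∀ W W' : Set V, IsCompOf X W Lᶜ → W ⊆ A i → W' ⊆ A j →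
      W ≠ W' := by
    rintro i j hij W _ hc hs hs' rfl
    obtain ⟨x, hx⟩ := hc.2.1
    exact Set.disjoint_left.1 (hA.disjoint i j hij) (hs hx) (hs' hx)
  have n23 := ne 2 3 (by decide) _ _ hc₂ hs₂ hs₃
  have n24 := ne 2 4 (by decide) _ _ hc₂ hs₂ hs₄
  have n34 := ne 3 4 (by decide) _ _ hc₃ hs₃ hs₄
  rcases hU W₂ hc₂ hw₂ with rfl | rfl <;> rcases hU W₃ hc₃ hw₃ with rfl | rfl <;>
    rcases hU W₄ hc₄ hw₄ with rfl | rfl <;> simp at n23 n24 n34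

lemma exists_infinite_comp [Infinite V] (hconn : X.Connected)
    (hlf : ∀ v : V, (X.neighborSet v).Finite) {K : Set V} (hK : K.Finite) :
    ∃ U, IsCompOf X U Kᶜ ∧ U.Infinite := by
  obtain ⟨v⟩ := hconn.nonempty
  obtain ⟨R, hR⟩ := exists_subset_cball (X := X) hK v
  obtain ⟨γ, -, hadj, hdist, -⟩ := exists_ray hconn hlf v (Set.infinite_univ (α := V))
  have hγ : ∀ n, γ (R + 1 + n) ∈ Kᶜ := fun n hn => by
    have h : X.dist v (γ (R + 1 + n)) ≤ R := hR hn
    rw [hdist] at h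
    omega
  refine ⟨_, isCompOf_joined (hγ 0), ?_⟩
  refine Set.infinite_of_injective_forall_mem (f := fun n => γ (R + 1 + n)) ?_ fun n => ?_
  · intro k l hkl
    have := congrArg (X.dist v) hkl
    simp only [hdist] at this
    omega
  · induction n with
    | zero => exact .refl (hγ 0)
    | succ n ih => exact Joined.trans ih (.of_adj (hγ n) (hγ (n + 1)) (hadj _))

end OneEnded

theorem statement_1 {V : Type*} (X : SimpleGraph V)
    (hinf : Infinite V) (hconn : X.Connected)
    (hlf : ∀ v : V, (X.neighborSet v).Finite)
    (htrans : ∀ u v : V, ∃ φ : X ≃g X, φ u = v)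
    (σ : ℝ) (hσ : 0 < σ) (hubq : UBQ X σ) :
    ∀ K : Set V, K.Finite → ∃! U : Set V, IsCompOf X U Kᶜ ∧ U.Infinite := by
  intro K hK
  obtain ⟨U, hU, hUinf⟩ := OneEnded.exists_infinite_comp hconn hlf hK
  refine ⟨U, ⟨hU, hUinf⟩, ?_⟩
  rintro U' ⟨hU', hUinf'⟩
  by_contra hne
  have hdisj : Disjoint U U' := by
    refine Set.disjoint_left.2 fun x hx hx' => hne ?_
    rw [OneEnded.eq_joined_of_isCompOf hU hx, OneEnded.eq_joined_of_isCompOf hU' hx']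
  obtain ⟨v⟩ := hconn.nonempty
  obtain ⟨R, hR⟩ := OneEnded.exists_subset_cball (X := X) hK v
  have hfin := OneEnded.cball_finite hconn hlf v R
  have hcl := (OneEnded.closedOff_of_isCompOf hU).diff hR
  have hcl' := (OneEnded.closedOff_of_isCompOf hU').diff hR
  have hd : Disjoint (U \ OneEnded.cball X v R) (U' \ OneEnded.cball X v R) :=
    hdisj.mono Set.sdiff_subset Set.sdiff_subset
  have h₂ : OneEnded.IsSep X v R ![U \ OneEnded.cball X v R, U' \ OneEnded.cball X v R] := by
    refine ⟨fun i => ?_, fun i => ?_, fun i j hij => ?_⟩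
    · fin_cases i
      exacts [hUinf.sdiff hfin, hUinf'.sdiff hfin]
    · fin_cases i
      exacts [hcl, hcl']
    · fin_cases i <;> fin_cases j
      exacts [absurd rfl hij, hd, hd.symm, absurd rfl hij]
  obtain ⟨R₃, A₃, h₃⟩ := OneEnded.exists_isSep_three hconn hlf htrans hubq h₂
  obtain ⟨R₄, A₄, h₄⟩ := h₃.exists_double (k := 4) hconn hlf htrans (by decide) (by decide)
  obtain ⟨R₅, A₅, h₅⟩ := h₄.exists_double (k := 5) hconn hlf htrans (by decide) (by decide)
  exact OneEnded.not_isSep_five hconn hlf htrans hσ hubq h₅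
end

section
/- Assume the conventions: X is an infinite, connected, locally finite, vertex-transitive simple graph satisfying (UBQ) with separation constant σ > 0. Let ρ be a bi-infinite quasi-geodesic and let U be a wide connected component of V ∖ N_σ(ρ(ℤ)). Then there exists a one-way infinite path p with p(ℕ) ⊆ U such that d(p(t), ρ(ℤ)) → ∞ as t → ∞. -/
open SimpleGraph

section Components

variable {V : Type*} {X : SimpleGraph V}

lemma ConnSet.singleton (v : V) : ConnSet X {v} := by
  have : Subsingleton ({v} : Set V) := ⟨fun a b => Subtype.ext (a.2.trans b.2.symm)⟩
  have : Nonempty ({v} : Set V) := ⟨⟨v, rfl⟩⟩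
  exact ⟨Preconnected.of_subsingleton⟩

lemma ConnSet.union {A B : Set V} (hA : ConnSet X A) (hB : ConnSet X B)
    (h : (A ∩ B).Nonempty) : ConnSet X (A ∪ B) :=
  induce_union_connected hA.preconnected hB.preconnected h

/-- A subset of a connected set which contains a point and is closed under adjacency is
everything. -/
lemma ConnSet.subset_of_closed {Q A : Set V} (hQ : ConnSet X Q) {x₀ : V} (hx₀ : x₀ ∈ Q)
    (hA : x₀ ∈ A) (hcl : ∀ x ∈ Q, ∀ y ∈ Q, X.Adj x y → x ∈ A → y ∈ A) : Q ⊆ A := by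
  intro y hy
  obtain ⟨p⟩ := hQ.preconnected ⟨x₀, hx₀⟩ ⟨y, hy⟩
  have key : ∀ a b : Q, (X.induce Q).Walk a b → a.1 ∈ A → b.1 ∈ A := by
    intro a b p
    induction p with
    | nil => exact id
    | cons h p ih => exact fun ha => ih (hcl _ (Subtype.prop _) _ (Subtype.prop _) h ha)
  exact key _ _ p hA

/-- The component of `v` in `S`: the union of all connected subsets of `S` containing `v`. -/
def compOf (X : SimpleGraph V) (S : Set V) (v : V) : Set V :=
  ⋃₀ {Z | Z ⊆ S ∧ ConnSet X Z ∧ v ∈ Z}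

lemma subset_compOf {S Z : Set V} {v : V} (hZS : Z ⊆ S) (hZ : ConnSet X Z) (hv : v ∈ Z) :
    Z ⊆ compOf X S v :=
  Set.subset_sUnion_of_mem ⟨hZS, hZ, hv⟩

lemma mem_compOf_self {S : Set V} {v : V} (hv : v ∈ S) : v ∈ compOf X S v :=
  subset_compOf (Set.singleton_subset_iff.2 hv) (ConnSet.singleton v) rfl rfl

lemma isCompOf_compOf {S : Set V} {v : V} (hv : v ∈ S) : IsCompOf X (compOf X S v) S := by
  refine ⟨Set.sUnion_subset fun Z hZ => hZ.1, ⟨v, mem_compOf_self hv⟩, ?_, ?_⟩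
  · exact induce_sUnion_connected_of_pairwise_not_disjoint
      ⟨{v}, Set.singleton_subset_iff.2 hv, ConnSet.singleton v, rfl⟩
      (fun hs ht => ⟨v, hs.2.2, ht.2.2⟩) (fun hs => hs.2.1)
  · intro U' h h' hc
    exact (subset_compOf h' hc (h (mem_compOf_self hv))).antisymm h

/-- A connected subset of `S` meeting a component of `S` is contained in it. -/
lemma IsCompOf.subset_of_connSet {U S Z : Set V} (hU : IsCompOf X U S) (hZS : Z ⊆ S)
    (hZ : ConnSet X Z) (h : (U ∩ Z).Nonempty) : Z ⊆ U := by
  have := hU.2.2.2 (U ∪ Z) Set.subset_union_left (Set.union_subset hU.1 hZS)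
    (hU.2.2.1.union hZ h)
  exact this ▸ Set.subset_union_right

lemma IsCompOf.mem_of_adj {U S : Set V} (hU : IsCompOf X U S) {x y : V} (hx : x ∈ U)
    (hy : y ∈ S) (h : X.Adj x y) : y ∈ U := by
  refine hU.subset_of_connSet (Z := {x, y}) ?_ (induce_pair_connected_of_adj h)
    ⟨x, hx, by simp⟩ (by simp)
  rintro z (rfl | rfl)
  exacts [hU.1 hx, hy]

lemma IsCompOf.eq_of_inter_nonempty {U U' S : Set V} (hU : IsCompOf X U S)
    (hU' : IsCompOf X U' S) (h : (U ∩ U').Nonempty) : U = U' :=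
  (hU'.subset_of_connSet hU.1 hU.2.2.1 (by rwa [Set.inter_comm])).antisymm
    (hU.subset_of_connSet hU'.1 hU'.2.2.1 h)

/-- Two points of a connected set lie in a finite connected subset. -/
lemma ConnSet.exists_finite {Q : Set V} (hQ : ConnSet X Q) {x y : V} (hx : x ∈ Q)
    (hy : y ∈ Q) : ∃ Z ⊆ Q, Z.Finite ∧ ConnSet X Z ∧ x ∈ Z ∧ y ∈ Z := by
  refine hQ.subset_of_closed
    (A := {y | ∃ Z ⊆ Q, Z.Finite ∧ ConnSet X Z ∧ x ∈ Z ∧ y ∈ Z}) hx ?_ ?_ hy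
  · exact ⟨{x}, Set.singleton_subset_iff.2 hx, Set.finite_singleton x, ConnSet.singleton x,
      rfl, rfl⟩
  · rintro a ha b hb hab ⟨Z, hZQ, hZf, hZ, hxZ, haZ⟩
    refine ⟨Z ∪ {a, b}, Set.union_subset hZQ ?_, hZf.union (by simp),
      hZ.union (induce_pair_connected_of_adj hab) ⟨a, haZ, by simp⟩, Or.inl hxZ, by simp⟩
    rintro z (rfl | rfl) <;> assumption

lemma ConnSet.exists_walk {Q : Set V} (hQ : ConnSet X Q) {x y : V} (hx : x ∈ Q)
    (hy : y ∈ Q) : ∃ p : X.Walk x y, ∀ z ∈ p.support, z ∈ Q := by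
  obtain ⟨p⟩ := hQ.preconnected ⟨x, hx⟩ ⟨y, hy⟩
  have key : ∀ a b : Q, (X.induce Q).Walk a b →
      ∃ p : X.Walk a.1 b.1, ∀ z ∈ p.support, z ∈ Q := by
    intro a b p
    induction p with
    | @nil a => exact ⟨Walk.nil, by simp⟩
    | @cons a b c h p ih =>
      obtain ⟨q, hq⟩ := ih
      have h' : X.Adj a.1 b.1 := h
      exact ⟨Walk.cons h' q, by simpa using hq⟩
  exact key _ _ p

end Components

section Metric

variable {V : Type*} {X : SimpleGraph V}

/-- Points on a geodesic from `x` to `y`. -/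
lemma SimpleGraph.Connected.exists_dist_eq_sub (hconn : X.Connected) (x y : V) {j : ℕ}
    (hj : j ≤ X.dist x y) : ∃ a, X.dist a y = j ∧ X.dist x a = X.dist x y - j := by
  obtain ⟨p, hp⟩ := hconn.exists_walk_length_eq_dist x y
  have h1 := dist_le (p.take (X.dist x y - j))
  have h2 := dist_le (p.drop (X.dist x y - j))
  rw [Walk.take_length] at h1
  rw [Walk.drop_length] at h2
  have h3 := hconn.dist_triangle (u := x) (v := p.getVert (X.dist x y - j)) (w := y)
  exact ⟨p.getVert (X.dist x y - j), by omega, by omega⟩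

lemma SimpleGraph.Connected.exists_adj_dist_eq (hconn : X.Connected) {x y : V} {n : ℕ}
    (h : X.dist x y = n + 1) : ∃ a, X.Adj x a ∧ X.dist a y = n := by
  obtain ⟨a, ha, ha'⟩ := hconn.exists_dist_eq_sub x y (j := n) (by omega)
  exact ⟨a, dist_eq_one_iff_adj.1 (by omega), ha⟩

lemma finite_dist_le (hconn : X.Connected) (hlf : ∀ v : V, (X.neighborSet v).Finite) (v : V)
    (n : ℕ) : {x | X.dist x v ≤ n}.Finite := by
  induction n with
  | zero =>
    refine (Set.finite_singleton v).subset fun x hx => ?_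
    exact hconn.dist_eq_zero_iff.1 (Nat.le_zero.1 hx)
  | succ n ih =>
    refine (ih.union (ih.biUnion fun a _ => hlf a)).subset fun x hx => ?_
    rcases Nat.lt_or_ge n (X.dist x v) with h | h
    · obtain ⟨a, ha, ha'⟩ := hconn.exists_adj_dist_eq (n := n) (le_antisymm hx h)
      exact Or.inr (Set.mem_biUnion (x := a) ha'.le ha.symm)
    · exact Or.inl h

lemma finite_dist_le_real (hconn : X.Connected) (hlf : ∀ v : V, (X.neighborSet v).Finite)
    (v : V) (K : ℝ) : {x | (X.dist x v : ℝ) ≤ K}.Finite :=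
  (finite_dist_le hconn hlf v ⌊K⌋₊).subset fun _ hx => Nat.le_floor hx

lemma dist_triangle_real (hconn : X.Connected) (u v w : V) :
    (X.dist u w : ℝ) ≤ X.dist u v + X.dist v w := by
  exact_mod_cast hconn.dist_triangle

lemma dist_iso (hconn : X.Connected) (φ : X ≃g X) (x y : V) :
    X.dist (φ x) (φ y) = X.dist x y := by
  have key : ∀ (ψ : X ≃g X) (x y : V), X.dist (ψ x) (ψ y) ≤ X.dist x y := by
    intro ψ x y
    obtain ⟨p, hp⟩ := hconn.exists_walk_length_eq_dist x y
    have := dist_le (p.map ψ.toHom)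
    rwa [Walk.length_map, hp] at this
  refine (key φ x y).antisymm ?_
  simpa using key φ.symm (φ x) (φ y)

lemma IsCompOf.closedBall_subset {U S : Set V} (hconn : X.Connected) (hU : IsCompOf X U S)
    {x : V} (hx : x ∈ U) {m : ℕ} (hS : ∀ y, X.dist y x ≤ m → y ∈ S) :
    ∀ y, X.dist y x ≤ m → y ∈ U := by
  suffices h : ∀ n ≤ m, ∀ y, X.dist y x = n → y ∈ U from fun y hy => h _ hy y rfl
  intro n
  induction n with
  | zero =>
    intro _ y hy
    rwa [hconn.dist_eq_zero_iff.1 hy]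
  | succ n ih =>
    intro hn y hy
    obtain ⟨a, hya, ha⟩ := hconn.exists_adj_dist_eq hy
    exact hU.mem_of_adj (ih (by omega) a ha) (hS y (by omega)) hya.symm

end Metric

section Narrow

variable {V : Type*} {X : SimpleGraph V}

lemma Narrow.mono {Z Z' : Set V} (h : Narrow X Z') (hZ : Z ⊆ Z') : Narrow X Z := by
  obtain ⟨lam, c, f, h1, h2, hf⟩ := h
  exact ⟨lam, c, fun x => f ⟨x, hZ x.2⟩, h1, h2, fun x y => hf ⟨x, hZ x.2⟩ ⟨y, hZ y.2⟩⟩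

lemma Wide.mono {Z Z' : Set V} (h : Wide X Z) (hZ : Z ⊆ Z') : Wide X Z' :=
  fun h' => h (h'.mono hZ)

lemma Wide.exists_ne {Z : Set V} (h : Wide X Z) (x : V) : ∃ z ∈ Z, z ≠ x := by
  by_contra! H
  refine h ⟨1, 0, fun _ => 0, le_rfl, le_rfl, fun a b => ?_⟩
  simp [H a a.2, H b b.2]

lemma dist_path_le (hconn : X.Connected) {ρ : ℤ → V} (hρ : ∀ n, X.Adj (ρ n) (ρ (n + 1)))
    (s t : ℤ) : (X.dist (ρ s) (ρ t) : ℝ) ≤ |(s : ℝ) - t| := by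
  have key : ∀ (n : ℕ) (s : ℤ), X.dist (ρ s) (ρ (s + n)) ≤ n := by
    intro n s
    induction n with
    | zero => simp
    | succ n ih =>
      have h1 := hconn.dist_triangle (u := ρ s) (v := ρ (s + n)) (w := ρ (s + n + 1))
      rw [dist_eq_one_iff_adj.2 (hρ (s + n))] at h1
      push_cast
      rw [← add_assoc]
      omega
  wlog h : s ≤ t generalizing s t
  · rw [dist_comm, abs_sub_comm]
    exact this t s (by omega)
  obtain ⟨n, rfl⟩ := Int.le.dest h
  have : (X.dist (ρ s) (ρ (s + n)) : ℝ) ≤ n := by exact_mod_cast key n s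
  simpa using this

/-- A bounded neighbourhood of a quasi-geodesic is narrow. -/
lemma IsBiQuasiGeodesic.narrow_gnbhd (hconn : X.Connected) {ρ : ℤ → V}
    (hρ : IsBiQuasiGeodesic X ρ) (M : ℝ) : Narrow X (gnbhd X (Set.range ρ) M) := by
  obtain ⟨lam, c, hlam, hc, hadj, hqg⟩ := hρ
  have hs : ∀ x : gnbhd X (Set.range ρ) M, ∃ s : ℤ, (X.dist x.1 (ρ s) : ℝ) ≤ M := by
    rintro ⟨x, _, ⟨s, rfl⟩, h⟩
    exact ⟨s, h⟩
  choose s hs using hs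
  by_cases hM : 0 ≤ M
  · refine ⟨lam, lam * (2 * M + c) + 2 * M, fun x => s x, hlam, by positivity,
      fun x y => ⟨?_, ?_⟩⟩
    · have h1 := hqg (s x) (s y)
      rw [sub_le_iff_le_add, div_le_iff₀ (by linarith)] at h1
      have h2 := dist_triangle_real hconn (ρ (s x)) x.1 (ρ (s y))
      have h3 := dist_triangle_real hconn x.1 y.1 (ρ (s y))
      have h4 := hs x
      rw [dist_comm] at h4
      have h5 := hs y
      nlinarith
    · have h1 := dist_path_le hconn hadj (s x) (s y)
      have h2 := dist_triangle_real hconn x.1 (ρ (s x)) y.1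
      have h3 := dist_triangle_real hconn (ρ (s x)) (ρ (s y)) y.1
      have h4 := hs x
      have h5 := hs y
      rw [dist_comm] at h5
      have h6 : 0 ≤ lam * (2 * M + c) := by positivity
      nlinarith [abs_nonneg ((s x : ℝ) - s y)]
  · have : ∀ x : gnbhd X (Set.range ρ) M, False := fun x =>
      hM (le_trans (Nat.cast_nonneg _) (hs x))
    exact ⟨1, 0, fun _ => 0, le_rfl, le_rfl, fun x => (this x).elim⟩

/-- In a vertex-transitive graph, a narrow set containing balls of every radius forces the
whole graph to be narrow. -/
lemma Narrow.univ_of_closedBall_subset (hconn : X.Connected)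
    (htrans : ∀ u v : V, ∃ φ : X ≃g X, φ u = v) {Z : Set V} (hZ : Narrow X Z)
    (hb : ∀ m : ℕ, ∃ x, ∀ y, X.dist y x ≤ m → y ∈ Z) : Narrow X Set.univ := by
  obtain ⟨lam, c, f, hlam, hc, hf⟩ := hZ
  choose x hx using hb
  set v := x 0
  choose φ hφ using fun m => htrans v (x m)
  have hmem : ∀ m y, X.dist y v ≤ m → φ m y ∈ Z := fun m y h =>
    hx m _ (by rwa [← hφ m, dist_iso hconn])
  classical
  let g : ℕ → V → ℝ := fun m y =>
    if h : X.dist y v ≤ m then f ⟨φ m y, hmem m y h⟩ - f ⟨φ m v, hmem m v (by simp)⟩ else 0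
  have hg : ∀ m y z, X.dist y v ≤ m → X.dist z v ≤ m →
      |g m y - g m z| ≤ lam * X.dist y z + c ∧ (X.dist y z : ℝ) ≤ lam * |g m y - g m z| + c := by
    intro m y z hy hz
    have := hf ⟨φ m y, hmem m y hy⟩ ⟨φ m z, hmem m z hz⟩
    simpa [g, hy, hz, dist_iso hconn] using this
  have hbd : ∀ m y, g m y ∈ Set.Icc (-(lam * X.dist y v + c)) (lam * X.dist y v + c) := by
    intro m y
    rw [Set.mem_Icc, ← abs_le]
    by_cases hy : X.dist y v ≤ m
    · have h1 := (hg m y v hy (by simp)).1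
      have h2 : g m v = 0 := by simp [g]
      simpa [h2] using h1
    · simp only [g, hy, dite_false, abs_zero]
      positivity
  let F : Ultrafilter ℕ := Filter.hyperfilter ℕ
  have hlim : ∀ y, ∃ a, Filter.Tendsto (fun m => g m y) F (nhds a) := by
    intro y
    obtain ⟨a, -, ha⟩ := (isCompact_Icc (a := -(lam * (X.dist y v : ℝ) + c))
      (b := lam * X.dist y v + c)).ultrafilter_le_nhds (F.map fun m => g m y)
      (by
        rw [Filter.le_principal_iff]
        exact Filter.mem_map.2 (Filter.Eventually.of_forall fun m => hbd m y))
    exact ⟨a, ha⟩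
  choose G hG using hlim
  have hev : ∀ y : V, ∀ᶠ m in (F : Filter ℕ), X.dist y v ≤ m := fun y =>
    Nat.hyperfilter_le_atTop (Filter.eventually_ge_atTop _)
  refine ⟨lam, c, fun y => G y, hlam, hc, fun y z => ?_⟩
  have hd := ((hG y.1).sub (hG z.1)).abs
  constructor
  · refine le_of_tendsto hd ?_
    filter_upwards [hev y, hev z] with m h1 h2 using (hg m _ _ h1 h2).1
  · refine ge_of_tendsto ((hd.const_mul lam).add_const c) ?_
    filter_upwards [hev y, hev z] with m h1 h2 using (hg m _ _ h1 h2).2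

end Narrow

section Filling

variable {V : Type*} {X : SimpleGraph V}

lemma exists_walk_bounce {u v : V} (h : X.Adj u v) (l : ℕ) :
    ∃ p : X.Walk u v, p.length = 2 * l + 1 ∧ ∀ x ∈ p.support, x = u ∨ x = v := by
  induction l with
  | zero => exact ⟨Walk.cons h Walk.nil, by simp⟩
  | succ l ih =>
    obtain ⟨p, hp, hs⟩ := ih
    refine ⟨Walk.cons h (Walk.cons h.symm p), by simp [hp]; ring, ?_⟩
    intro x hx
    simp only [Walk.support_cons, List.mem_cons] at hx
    rcases hx with rfl | rfl | hx
    exacts [Or.inl rfl, Or.inr rfl, hs x hx]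

lemma exists_walk_cover (hconn : X.Connected) (v : V) (k : ℕ) {T : Set V} (hT : T.Finite)
    (hTk : ∀ x ∈ T, X.dist x v ≤ k) :
    ∃ p : X.Walk v v, (∀ x ∈ T, x ∈ p.support) ∧ ∀ x ∈ p.support, X.dist x v ≤ k := by
  classical
  induction T, hT using Set.Finite.induction_on with
  | empty => exact ⟨Walk.nil, by simp⟩
  | @insert a T _ _ ih =>
    obtain ⟨p, hp, hp'⟩ := ih fun x hx => hTk x (Set.mem_insert_of_mem _ hx)
    obtain ⟨q, hq⟩ := hconn.exists_walk_length_eq_dist v a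
    have hqs : ∀ x ∈ q.support, X.dist x v ≤ k := fun x hx => by
      have h1 := dist_le (q.takeUntil x hx)
      have h2 := q.length_takeUntil_le_length hx
      have h3 := hTk a (Set.mem_insert _ _)
      rw [SimpleGraph.dist_comm] at h3 ⊢
      omega
    refine ⟨(q.append q.reverse).append p, ?_, ?_⟩
    · rintro x (rfl | hx)
      · simp [Walk.mem_support_append_iff]
      · simp [Walk.mem_support_append_iff, hp x hx]
    · intro x hx
      simp only [Walk.mem_support_append_iff, Walk.support_reverse, List.mem_reverse,
        or_self] at hx
      exact hx.elim (hqs x) (hp' x)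

/-- Closed walks of a common even length which sweep out the balls of radius `k`. -/
lemma exists_closedBall_walk (hconn : X.Connected)
    (hlf : ∀ v : V, (X.neighborSet v).Finite) (htrans : ∀ u v : V, ∃ φ : X ≃g X, φ u = v)
    (k : ℕ) : ∃ l : ℕ, ∀ v, ∃ p : X.Walk v v, p.length = 2 * l ∧
      ∀ x, x ∈ p.support ↔ X.dist x v ≤ k := by
  obtain ⟨v₀⟩ := hconn.nonempty
  obtain ⟨p, hp, hp'⟩ := exists_walk_cover hconn v₀ k (finite_dist_le hconn hlf v₀ k)
    fun _ => id
  refine ⟨p.length, fun v => ?_⟩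
  obtain ⟨φ, rfl⟩ := htrans v₀ v
  refine ⟨(p.append p).map φ.toHom, by simp [two_mul], fun x => ?_⟩
  have hmem : ∀ y, y ∈ (p.append p).support ↔ X.dist y v₀ ≤ k := fun y => by
    rw [Walk.mem_support_append_iff, or_self]
    exact ⟨hp' y, hp y⟩
  rw [Walk.support_map, List.mem_map]
  constructor
  · rintro ⟨y, hy, rfl⟩
    exact (dist_iso hconn φ y v₀).trans_le ((hmem y).1 hy)
  · intro hx
    obtain ⟨y, rfl⟩ := φ.surjective x
    exact ⟨y, (hmem y).2 (by rwa [dist_iso hconn] at hx), rfl⟩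

/-- The path `ρ` together with the balls of radius `k` around `ρ s`, for `s ∈ S`. -/
def fillSet (X : SimpleGraph V) (ρ : ℤ → V) (S : Set ℤ) (k : ℕ) : Set V :=
  Set.range ρ ∪ {x | ∃ s ∈ S, X.dist x (ρ s) ≤ k}

/-- The concatenation of walks of length `L` joining consecutive points of `ρ`. -/
def concatPath {ρ : ℤ → V} (w : ∀ n : ℤ, X.Walk (ρ n) (ρ (n + 1))) (L : ℕ) (m : ℤ) : V :=
  (w (m / L)).getVert (m % L).toNat

lemma concatPath_eq {ρ : ℤ → V} (w : ∀ n : ℤ, X.Walk (ρ n) (ρ (n + 1))) (L : ℕ) {m n : ℤ}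
    {i : ℕ} (h : m / L = n) (h' : m % L = i) : concatPath w L m = (w n).getVert i := by
  subst h
  simp [concatPath, h']

/-- Concatenating walks of a common length joining consecutive points of a quasi-geodesic
yields a quasi-geodesic. -/
lemma IsBiQuasiGeodesic.concat_walks (hconn : X.Connected) {ρ : ℤ → V}
    (hρ : IsBiQuasiGeodesic X ρ) {L : ℕ} (hL : 0 < L)
    (w : ∀ n : ℤ, X.Walk (ρ n) (ρ (n + 1))) (hw : ∀ n, (w n).length = L) :
    IsBiQuasiGeodesic X (concatPath w L) := by
  obtain ⟨lam, c, hlam, hc, -, hqg⟩ := hρ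
  have hL' : (0 : ℤ) < L := by exact_mod_cast hL
  have hLr : (1 : ℝ) ≤ L := by exact_mod_cast hL
  refine ⟨lam * L, c + 2 * L + 1, by nlinarith, by positivity, fun m => ?_, fun s t => ?_⟩
  · have h0 := Int.emod_nonneg m hL'.ne'
    have h1 := Int.emod_lt_of_pos m hL'
    have h2 := Int.emod_add_mul_ediv m L
    have hadj := (w (m / L)).adj_getVert_succ (i := (m % L).toNat) (by rw [hw]; omega)
    rcases lt_or_eq_of_le (show m % L + 1 ≤ L by omega) with h | h
    · have hd : (m + 1) / L = m / L := by
        rw [Int.ediv_eq_iff_of_pos hL']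
        constructor <;> nlinarith
      have hm : (m + 1) % L = m % L + 1 := by
        have := Int.emod_add_mul_ediv (m + 1) L
        rw [hd] at this
        omega
      rw [concatPath_eq w L hd (i := (m % L).toNat + 1) (by omega)]
      exact hadj
    · have hd : (m + 1) / L = m / L + 1 := by
        rw [Int.ediv_eq_iff_of_pos hL']
        constructor <;> nlinarith
      have hm : (m + 1) % L = 0 := by
        have := Int.emod_add_mul_ediv (m + 1) L
        rw [hd, mul_add] at this
        omega
      have hn : (m % L).toNat + 1 = (w (m / L)).length := by rw [hw]; omega
      rw [hn, Walk.getVert_length] at hadj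
      rw [concatPath_eq w L hd (i := 0) (by simpa using hm), Walk.getVert_zero]
      exact hadj
  · have hnear : ∀ m : ℤ,
        (X.dist (ρ (m / L)) (concatPath w L m) : ℝ) ≤ L := by
      intro m
      have h1 := dist_le ((w (m / L)).take (m % L).toNat)
      rw [Walk.take_length, hw] at h1
      exact_mod_cast h1.trans (min_le_right _ _)
    have hdiv : ∀ m : ℤ, (L : ℝ) * ((m / L : ℤ) : ℝ) ≤ m ∧
        (m : ℝ) ≤ L * ((m / L : ℤ) : ℝ) + L := by
      intro m
      have h1 := Int.mul_ediv_self_le (x := m) hL'.ne'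
      have h2 := (Int.lt_mul_ediv_self_add (x := m) hL').le
      exact ⟨by exact_mod_cast h1, by exact_mod_cast h2⟩
    set a := concatPath w L s
    set b := concatPath w L t
    have h1 := hqg (s / L) (t / L)
    have h2 := hnear s
    have h3 := hnear t
    have h4 := dist_triangle_real hconn (ρ (s / L)) a (ρ (t / L))
    have h5 := dist_triangle_real hconn a b (ρ (t / L))
    rw [SimpleGraph.dist_comm] at h3
    obtain ⟨hs1, hs2⟩ := hdiv s
    obtain ⟨ht1, ht2⟩ := hdiv t
    have h6 : |(s : ℝ) - t| ≤ L * |((s / L : ℤ) : ℝ) - ((t / L : ℤ) : ℝ)| + L := by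
      have h7 : |(L : ℝ) * (((s / L : ℤ) : ℝ) - ((t / L : ℤ) : ℝ))|
          = L * |((s / L : ℤ) : ℝ) - ((t / L : ℤ) : ℝ)| := by
        rw [abs_mul, abs_of_pos (by linarith)]
      rw [← h7, abs_le]
      have h8 := le_abs_self ((L : ℝ) * (((s / L : ℤ) : ℝ) - ((t / L : ℤ) : ℝ)))
      have h9 := neg_abs_le ((L : ℝ) * (((s / L : ℤ) : ℝ) - ((t / L : ℤ) : ℝ)))
      constructor <;> linarith
    have h7 : |(s : ℝ) - t| / (lam * L) ≤
        |((s / L : ℤ) : ℝ) - ((t / L : ℤ) : ℝ)| / lam + 1 := by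
      have hpos : 0 < lam * L := by positivity
      rw [div_le_iff₀ hpos]
      have : (|((s / L : ℤ) : ℝ) - ((t / L : ℤ) : ℝ)| / lam + 1) * (lam * L)
          = L * |((s / L : ℤ) : ℝ) - ((t / L : ℤ) : ℝ)| + lam * L := by
        field_simp
      rw [this]
      nlinarith
    linarith

/-- Every set `fillSet X ρ S k` is the range of a bi-infinite quasi-geodesic. -/
lemma exists_quasiGeodesic_range_eq_fillSet (hconn : X.Connected)
    (hlf : ∀ v : V, (X.neighborSet v).Finite) (htrans : ∀ u v : V, ∃ φ : X ≃g X, φ u = v)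
    {ρ : ℤ → V} (hρ : IsBiQuasiGeodesic X ρ) (S : Set ℤ) (k : ℕ) :
    ∃ ρ' : ℤ → V, IsBiQuasiGeodesic X ρ' ∧ Set.range ρ' = fillSet X ρ S k := by
  obtain ⟨l, hl⟩ := exists_closedBall_walk hconn hlf htrans k
  have hadj : ∀ n, X.Adj (ρ n) (ρ (n + 1)) := by
    obtain ⟨_, _, _, _, h, _⟩ := hρ
    exact h
  have hw : ∀ n : ℤ, ∃ w : X.Walk (ρ n) (ρ (n + 1)), w.length = 2 * l + 1 ∧
      (∀ x ∈ w.support, x ∈ fillSet X ρ S k) ∧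
      (n ∈ S → ∀ x, X.dist x (ρ n) ≤ k → x ∈ w.support) := by
    intro n
    by_cases hn : n ∈ S
    · obtain ⟨p, hp, hs⟩ := hl (ρ n)
      refine ⟨p.concat (hadj n), by rw [Walk.length_concat, hp], fun x hx => ?_,
        fun _ x hx => ?_⟩
      · rw [Walk.support_concat, List.mem_append, List.mem_singleton] at hx
        rcases hx with hx | rfl
        · exact Or.inr ⟨n, hn, (hs x).1 hx⟩
        · exact Or.inl ⟨_, rfl⟩
      · rw [Walk.support_concat, List.mem_append]
        exact Or.inl ((hs x).2 hx)
    · obtain ⟨p, hp, hs⟩ := exists_walk_bounce (hadj n) l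
      refine ⟨p, hp, fun x hx => ?_, fun h => (hn h).elim⟩
      rcases hs x hx with rfl | rfl <;> exact Or.inl ⟨_, rfl⟩
  choose w hwl hws hwS using hw
  have hL : (0 : ℤ) < (2 * l + 1 : ℕ) := by omega
  refine ⟨_, hρ.concat_walks hconn (L := 2 * l + 1) (by omega) w hwl, ?_⟩
  have hcov : ∀ n, ∀ x ∈ (w n).support, x ∈ Set.range (concatPath w (2 * l + 1)) := by
    intro n x hx
    obtain ⟨i, rfl, hi⟩ := Walk.mem_support_iff_exists_getVert.1 hx
    rw [hwl] at hi
    rcases hi.lt_or_eq with hi | hi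
    · refine ⟨n * (2 * l + 1 : ℕ) + i, ?_⟩
      have hi' : (i : ℤ) < (2 * l + 1 : ℕ) := by exact_mod_cast hi
      have hd : (n * (2 * l + 1 : ℕ) + i) / ((2 * l + 1 : ℕ) : ℤ) = n := by
        rw [add_comm, Int.add_mul_ediv_right _ _ hL.ne',
          Int.ediv_eq_zero_of_lt (by omega) hi', zero_add]
      have hm : (n * (2 * l + 1 : ℕ) + i) % ((2 * l + 1 : ℕ) : ℤ) = i := by
        rw [add_comm, Int.add_mul_emod_self_right, Int.emod_eq_of_lt (by omega) hi']
      exact concatPath_eq w _ hd hm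
    · refine ⟨(n + 1) * (2 * l + 1 : ℕ), ?_⟩
      have hd : ((n + 1) * (2 * l + 1 : ℕ)) / ((2 * l + 1 : ℕ) : ℤ) = n + 1 :=
        Int.mul_ediv_cancel _ hL.ne'
      have hm : ((n + 1) * (2 * l + 1 : ℕ)) % ((2 * l + 1 : ℕ) : ℤ) = 0 :=
        Int.mul_emod_left _ _
      rw [concatPath_eq w _ hd (i := 0) (by simp), Walk.getVert_zero, hi, ← hwl n,
        Walk.getVert_length]
  refine Set.Subset.antisymm ?_ ?_
  · rintro _ ⟨m, rfl⟩
    exact hws _ _ (Walk.getVert_mem_support _ _)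
  · rintro x (⟨n, rfl⟩ | ⟨s, hs, hx⟩)
    · exact hcov n _ (Walk.start_mem_support _)
    · exact hcov s x (hwS s hs x hx)

end Filling

section Levels

variable {V : Type*} {X : SimpleGraph V}

lemma gnbhd_mono (X : SimpleGraph V) (A : Set V) {r r' : ℝ} (h : r ≤ r') :
    gnbhd X A r ⊆ gnbhd X A r' :=
  fun _ ⟨a, ha, hx⟩ => ⟨a, ha, hx.trans h⟩

lemma mem_gnbhd_fillSet (hconn : X.Connected) {ρ : ℤ → V} {S : Set ℤ} {k : ℕ} {σ : ℝ}
    (hσ : 0 < σ) {x : V} : x ∈ gnbhd X (fillSet X ρ S k) σ ↔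
      x ∈ gnbhd X (Set.range ρ) σ ∨ ∃ s ∈ S, (X.dist x (ρ s) : ℝ) ≤ σ + k := by
  constructor
  · rintro ⟨a, ha | ⟨s, hs, ha⟩, hx⟩
    · exact Or.inl ⟨a, ha, hx⟩
    · have h1 := dist_triangle_real hconn x a (ρ s)
      have h2 : (X.dist a (ρ s) : ℝ) ≤ k := by exact_mod_cast ha
      exact Or.inr ⟨s, hs, by linarith⟩
  · rintro (⟨a, ha, hx⟩ | ⟨s, hs, hx⟩)
    · exact ⟨a, Or.inl ha, hx⟩
    · rcases le_total (X.dist x (ρ s)) k with h | h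
      · exact ⟨x, Or.inr ⟨s, hs, h⟩, by simpa using hσ.le⟩
      · obtain ⟨a, ha, hxa⟩ := hconn.exists_dist_eq_sub x (ρ s) h
        refine ⟨a, Or.inr ⟨s, hs, ha.le⟩, ?_⟩
        rw [hxa, Nat.cast_sub h]
        linarith

lemma UBQ.twoWideComps_fillSet {σ : ℝ} (hubq : UBQ X σ) (hconn : X.Connected)
    (hlf : ∀ v : V, (X.neighborSet v).Finite) (htrans : ∀ u v : V, ∃ φ : X ≃g X, φ u = v)
    {ρ : ℤ → V} (hρ : IsBiQuasiGeodesic X ρ) (S : Set ℤ) (k : ℕ) :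
    TwoWideComps X (gnbhd X (fillSet X ρ S k) σ)ᶜ := by
  obtain ⟨ρ', hρ', hr⟩ := exists_quasiGeodesic_range_eq_fillSet hconn hlf htrans hρ S k
  exact hr ▸ hubq ρ' hρ'

/-- The bisecting property passes to all larger neighbourhoods. -/
lemma UBQ.twoWideComps_add {σ : ℝ} (hσ : 0 < σ) (hubq : UBQ X σ) (hconn : X.Connected)
    (hlf : ∀ v : V, (X.neighborSet v).Finite) (htrans : ∀ u v : V, ∃ φ : X ≃g X, φ u = v)
    {ρ : ℤ → V} (hρ : IsBiQuasiGeodesic X ρ) (k : ℕ) :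
    TwoWideComps X (gnbhd X (Set.range ρ) (σ + k))ᶜ := by
  convert hubq.twoWideComps_fillSet hconn hlf htrans hρ Set.univ k using 2
  ext x
  rw [mem_gnbhd_fillSet hconn hσ]
  constructor
  · rintro ⟨_, ⟨s, rfl⟩, h⟩
    exact Or.inr ⟨s, trivial, h⟩
  · rintro (h | ⟨s, -, h⟩)
    · exact gnbhd_mono X _ (by simp) h
    · exact ⟨ρ s, ⟨s, rfl⟩, h⟩

/-- Narrow complementary components of a neighbourhood stay at bounded distance. -/
lemma IsCompOf.subset_gnbhd_of_narrow (hconn : X.Connected)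
    (htrans : ∀ u v : V, ∃ φ : X ≃g X, φ u = v) (hX : Wide X Set.univ) {A C : Set V} {K : ℝ}
    (hC : IsCompOf X C (gnbhd X A K)ᶜ) (hn : Narrow X C) :
    ∃ M, C ⊆ gnbhd X A M := by
  by_contra! H
  refine hX (hn.univ_of_closedBall_subset hconn htrans fun m => ?_)
  obtain ⟨x, hx, hxm⟩ := Set.not_subset.1 (H (K + m))
  refine ⟨x, hC.closedBall_subset hconn hx fun y hy ⟨a, ha, hya⟩ => hxm ⟨a, ha, ?_⟩⟩
  have h1 := dist_triangle_real hconn x y a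
  have h2 : (X.dist y x : ℝ) ≤ m := by exact_mod_cast hy
  rw [SimpleGraph.dist_comm] at h2
  linarith

lemma IsBiQuasiGeodesic.finite_near (hconn : X.Connected) {ρ : ℤ → V}
    (hρ : IsBiQuasiGeodesic X ρ) (x : V) (K : ℝ) : {s : ℤ | (X.dist x (ρ s) : ℝ) ≤ K}.Finite := by
  obtain ⟨lam, c, hlam, hc, -, hqg⟩ := hρ
  rcases Set.eq_empty_or_nonempty {s : ℤ | (X.dist x (ρ s) : ℝ) ≤ K} with h | ⟨s₀, h₀⟩
  · simp [h]
  · refine (Set.finite_Icc (s₀ - ⌈lam * (2 * K + c)⌉) (s₀ + ⌈lam * (2 * K + c)⌉)).subset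
      fun s hs => ?_
    have h1 := hqg s s₀
    rw [sub_le_iff_le_add, div_le_iff₀ (by linarith)] at h1
    have h2 := dist_triangle_real hconn (ρ s) x (ρ s₀)
    have h3 : (X.dist x (ρ s) : ℝ) ≤ K := hs
    have h4 : (X.dist x (ρ s₀) : ℝ) ≤ K := h₀
    rw [SimpleGraph.dist_comm] at h3
    have h5 : |(s : ℝ) - s₀| ≤ lam * (2 * K + c) := by nlinarith
    have h6 := abs_le.1 (h5.trans (Int.le_ceil _))
    rw [Set.mem_Icc]
    constructor
    · have : (s₀ : ℝ) - ⌈lam * (2 * K + c)⌉ ≤ s := by linarith [h6.1]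
      exact_mod_cast this
    · have : (s : ℝ) ≤ s₀ + ⌈lam * (2 * K + c)⌉ := by linarith [h6.2]
      exact_mod_cast this

/-- A connected set which meets the `K`-neighbourhood of `A` only in a finite set, and which
outside this neighbourhood consists of components of bounded depth, has bounded depth. -/
lemma ConnSet.subset_gnbhd_of_finite (hlf : ∀ v : V, (X.neighborSet v).Finite)
    {Q A P : Set V} {K : ℝ} (hQ : ConnSet X Q) (hP : P.Finite)
    (hQP : Q ∩ gnbhd X A K ⊆ P)
    (hdepth : ∀ t ∈ Q, t ∈ (gnbhd X A K)ᶜ →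
      ∃ M, compOf X (gnbhd X A K)ᶜ t ⊆ gnbhd X A M) :
    ∃ M, Q ⊆ gnbhd X A M := by
  obtain ⟨x₀, hx₀⟩ := hQ.nonempty
  set D : Set V := (gnbhd X A K)ᶜ
  let T : Set V := ({x₀} ∪ ⋃ x ∈ P, X.neighborSet x) ∩ (Q ∩ D)
  have hT : T.Finite :=
    ((Set.finite_singleton x₀).union (hP.biUnion fun x _ => hlf x)).inter_of_left _
  choose! M hM using fun t (ht : t ∈ Q ∩ D) => hdepth t ht.1 ht.2
  obtain ⟨B, hB⟩ := (hT.image M).bddAbove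
  have hsub : Q ⊆ {x | x ∈ gnbhd X A K ∨ ∃ t ∈ T, x ∈ compOf X D t} := by
    refine hQ.subset_of_closed hx₀ ?_ ?_
    · by_cases h : x₀ ∈ gnbhd X A K
      · exact Or.inl h
      · exact Or.inr ⟨x₀, ⟨Or.inl rfl, hx₀, h⟩, mem_compOf_self h⟩
    · intro x hx y hy hxy hxA
      by_cases hyK : y ∈ gnbhd X A K
      · exact Or.inl hyK
      · right
        rcases hxA with hxK | ⟨t, ht, hxt⟩
        · exact ⟨y, ⟨Or.inr (Set.mem_biUnion (hQP ⟨hx, hxK⟩) hxy), hy, hyK⟩,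
            mem_compOf_self hyK⟩
        · exact ⟨t, ht, (isCompOf_compOf ht.2.2).mem_of_adj hxt hyK hxy⟩
  refine ⟨max K B, fun x hx => ?_⟩
  rcases hsub hx with h | ⟨t, ht, h⟩
  · exact gnbhd_mono X A (le_max_left _ _) h
  · exact gnbhd_mono X A ((hB ⟨t, ht, rfl⟩).trans (le_max_right _ _)) (hM t ht.2 h)

lemma TwoWideComps.eq_or_eq {S W₁ W₂ W : Set V} (h : TwoWideComps X S)
    (h₁ : IsCompOf X W₁ S) (hw₁ : Wide X W₁) (h₂ : IsCompOf X W₂ S) (hw₂ : Wide X W₂)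
    (hne : W₁ ≠ W₂) (hW : IsCompOf X W S) (hw : Wide X W) : W = W₁ ∨ W = W₂ := by
  obtain ⟨U₁, U₂, -, -, -, -, -, H⟩ := h
  have := H W₁ h₁ hw₁
  have := H W₂ h₂ hw₂
  have := H W hW hw
  grind

/-- Distinct wide components at a deeper level lie in distinct components of the complement of
the `σ`-neighbourhood. -/
lemma UBQ.eq_of_subset {σ : ℝ} (hσ : 0 < σ) (hubq : UBQ X σ) (hconn : X.Connected)
    (hlf : ∀ v : V, (X.neighborSet v).Finite) (htrans : ∀ u v : V, ∃ φ : X ≃g X, φ u = v)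
    {ρ : ℤ → V} (hρ : IsBiQuasiGeodesic X ρ) {k : ℕ} {U W₁ W₂ : Set V}
    (hU : ConnSet X U) (hUσ : U ⊆ (gnbhd X (Set.range ρ) σ)ᶜ)
    (h₁ : IsCompOf X W₁ (gnbhd X (Set.range ρ) (σ + k))ᶜ) (hw₁ : Wide X W₁)
    (h₂ : IsCompOf X W₂ (gnbhd X (Set.range ρ) (σ + k))ᶜ) (hw₂ : Wide X W₂)
    (h₁U : W₁ ⊆ U) (h₂U : W₂ ⊆ U) : W₁ = W₂ := by
  by_contra hne
  obtain ⟨x₁, hx₁⟩ := h₁.2.1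
  obtain ⟨x₂, hx₂⟩ := h₂.2.1
  obtain ⟨Z, hZU, hZf, hZ, hx₁Z, hx₂Z⟩ := hU.exists_finite (h₁U hx₁) (h₂U hx₂)
  let S : Set ℤ := {s | ∀ x ∈ Z, ¬ (X.dist x (ρ s) : ℝ) ≤ σ + k}
  have hS : Sᶜ.Finite := by
    refine (hZf.biUnion fun x _ => hρ.finite_near hconn x (σ + k)).subset fun s hs => ?_
    simpa [S] using hs
  set D : Set V := (gnbhd X (fillSet X ρ S k) σ)ᶜ with hD
  have hKD : (gnbhd X (Set.range ρ) (σ + k))ᶜ ⊆ D := by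
    refine Set.compl_subset_compl.2 fun x hx => ?_
    rcases (mem_gnbhd_fillSet hconn hσ).1 hx with h | ⟨s, -, h⟩
    · exact gnbhd_mono X _ (by simp) h
    · exact ⟨ρ s, ⟨s, rfl⟩, h⟩
  have hZD : Z ⊆ D := by
    intro x hx hx'
    rcases (mem_gnbhd_fillSet hconn hσ).1 hx' with h | ⟨s, hs, h⟩
    · exact hUσ (hZU hx) h
    · exact hs x hx h
  have hY : ConnSet X (W₁ ∪ Z ∪ W₂) :=
    (h₁.2.2.1.union hZ ⟨x₁, hx₁, hx₁Z⟩).union h₂.2.2.1 ⟨x₂, Or.inr hx₂Z, hx₂⟩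
  have hYD : W₁ ∪ Z ∪ W₂ ⊆ D :=
    Set.union_subset (Set.union_subset (h₁.1.trans hKD) hZD) (h₂.1.trans hKD)
  have hQ₀ := isCompOf_compOf (X := X) (hZD hx₁Z)
  have hYQ₀ : W₁ ∪ Z ∪ W₂ ⊆ compOf X D x₁ := subset_compOf hYD hY (Or.inl (Or.inl hx₁))
  obtain ⟨Q, hQ, hQw, hQne⟩ : ∃ Q, IsCompOf X Q D ∧ Wide X Q ∧ Q ≠ compOf X D x₁ := by
    obtain ⟨Q₁, Q₂, hne', hQ₁, hQ₂, hQw₁, hQw₂, -⟩ := hubq.twoWideComps_fillSet hconn hlf htrans hρ S k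
    by_cases h : Q₁ = compOf X D x₁
    · exact ⟨Q₂, hQ₂, hQw₂, fun h' => hne' (h.trans h'.symm)⟩
    · exact ⟨Q₁, hQ₁, hQw₁, h⟩
  obtain ⟨M, hM⟩ := hQ.2.2.1.subset_gnbhd_of_finite hlf (A := Set.range ρ) (K := σ + k)
    (P := ⋃ s ∈ Sᶜ, {x | (X.dist x (ρ s) : ℝ) ≤ σ + k})
    (hS.biUnion fun s _ => finite_dist_le_real hconn hlf (ρ s) _)
    (by
      rintro x ⟨hxQ, _, ⟨s, rfl⟩, hx⟩
      exact Set.mem_biUnion (x := s)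
        (fun hs => hQ.1 hxQ ((mem_gnbhd_fillSet hconn hσ).2 (Or.inr ⟨s, hs, hx⟩))) hx)
    (by
      intro t htQ ht
      have hC := isCompOf_compOf (X := X) ht
      refine hC.subset_gnbhd_of_narrow hconn htrans (hw₁.mono (Set.subset_univ _))
        (not_not.1 fun hCw => hQne (hQ.eq_of_inter_nonempty hQ₀ ⟨t, htQ, ?_⟩))
      have htC := mem_compOf_self (X := X) ht
      rcases (hubq.twoWideComps_add hσ hconn hlf htrans hρ k).eq_or_eq h₁ hw₁ h₂ hw₂ hne hC hCw
        with h | h <;> rw [h] at htC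
      · exact hYQ₀ (Or.inl (Or.inl htC))
      · exact hYQ₀ (Or.inr htC))
  exact hQw ((hρ.narrow_gnbhd hconn M).mono hM)

/-- Every wide complementary component contains a wide component of every deeper level. -/
lemma UBQ.exists_wide_subset {σ : ℝ} (hσ : 0 < σ) (hubq : UBQ X σ) (hconn : X.Connected)
    (hlf : ∀ v : V, (X.neighborSet v).Finite) (htrans : ∀ u v : V, ∃ φ : X ≃g X, φ u = v)
    {ρ : ℤ → V} (hρ : IsBiQuasiGeodesic X ρ) {U : Set V}
    (hU : IsCompOf X U (gnbhd X (Set.range ρ) σ)ᶜ) (hUw : Wide X U) (k : ℕ) :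
    ∃ W ⊆ U, IsCompOf X W (gnbhd X (Set.range ρ) (σ + k))ᶜ ∧ Wide X W := by
  obtain ⟨W₁, W₂, hne, h₁, h₂, hw₁, hw₂, -⟩ :=
    hubq.twoWideComps_add hσ hconn hlf htrans hρ k
  have hsub : (gnbhd X (Set.range ρ) (σ + k))ᶜ ⊆ (gnbhd X (Set.range ρ) σ)ᶜ :=
    Set.compl_subset_compl.2 (gnbhd_mono X _ (by simp))
  have key : ∀ W, IsCompOf X W (gnbhd X (Set.range ρ) (σ + k))ᶜ → Wide X W →
      ∃ U', IsCompOf X U' (gnbhd X (Set.range ρ) σ)ᶜ ∧ Wide X U' ∧ W ⊆ U' := by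
    intro W hW hw
    obtain ⟨x, hx⟩ := hW.2.1
    have h := subset_compOf (hW.1.trans hsub) hW.2.2.1 hx
    exact ⟨_, isCompOf_compOf (hsub (hW.1 hx)), hw.mono h, h⟩
  obtain ⟨U₁, hU₁, hUw₁, hWU₁⟩ := key W₁ h₁ hw₁
  obtain ⟨U₂, hU₂, hUw₂, hWU₂⟩ := key W₂ h₂ hw₂
  have hne' : U₁ ≠ U₂ := fun h => hne (hubq.eq_of_subset hσ hconn hlf htrans hρ hU₁.2.2.1
    hU₁.1 h₁ hw₁ h₂ hw₂ hWU₁ (h ▸ hWU₂))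
  rcases (hubq ρ hρ).eq_or_eq hU₁ hUw₁ hU₂ hUw₂ hne' hU hUw with rfl | rfl
  exacts [⟨W₁, hWU₁, h₁, hw₁⟩, ⟨W₂, hWU₂, h₂, hw₂⟩]

end Levels

section Rays

variable {V : Type*} {X : SimpleGraph V}

/-- Concatenation of a sequence of nontrivial walks: a ray which from some time on only visits
the walks of large index. -/
lemma exists_ray_of_walks {w : ℕ → V} (P : ∀ k, X.Walk (w k) (w (k + 1)))
    (hP : ∀ k, 0 < (P k).length) : ∃ (p : ℕ → V) (κ : ℕ → ℕ), IsRay X p ∧ Monotone κ ∧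
      (∀ n, ∃ t, n ≤ κ t) ∧ ∀ t, p t ∈ (P (κ t)).support := by
  let step : ℕ × ℕ → ℕ × ℕ := fun a =>
    if a.2 + 1 < (P a.1).length then (a.1, a.2 + 1) else (a.1 + 1, 0)
  let st : ℕ → ℕ × ℕ := fun t => step^[t] (0, 0)
  have hst : ∀ t, st (t + 1) = step (st t) := fun t => Function.iterate_succ_apply' _ _ _
  have hst₁ : ∀ t, (st t).2 + 1 < (P (st t).1).length →
      st (t + 1) = ((st t).1, (st t).2 + 1) := fun t h => (hst t).trans (if_pos h)
  have hst₂ : ∀ t, ¬ (st t).2 + 1 < (P (st t).1).length →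
      st (t + 1) = ((st t).1 + 1, 0) := fun t h => (hst t).trans (if_neg h)
  have hlt : ∀ t, (st t).2 < (P (st t).1).length := by
    intro t
    induction t with
    | zero => exact hP 0
    | succ t ih =>
      by_cases h : (st t).2 + 1 < (P (st t).1).length
      · rwa [hst₁ t h]
      · rw [hst₂ t h]
        exact hP _
  refine ⟨fun t => (P (st t).1).getVert (st t).2, fun t => (st t).1, fun t => ?_,
    monotone_nat_of_le_succ fun t => ?_, fun n => ?_, fun t => Walk.getVert_mem_support _ _⟩
  · have hadj := (P (st t).1).adj_getVert_succ (hlt t)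
    beta_reduce
    by_cases h : (st t).2 + 1 < (P (st t).1).length
    · rwa [hst₁ t h]
    · rw [hst₂ t h, Walk.getVert_zero]
      rwa [show (st t).2 + 1 = (P (st t).1).length by have := hlt t; omega,
        Walk.getVert_length] at hadj
  · by_cases h : (st t).2 + 1 < (P (st t).1).length
    · rw [hst₁ t h]
    · rw [hst₂ t h]
      exact Nat.le_succ _
  · suffices h : ∃ t, st t = (n, 0) by
      obtain ⟨t, ht⟩ := h
      exact ⟨t, (congrArg Prod.fst ht).ge⟩
    induction n with
    | zero => exact ⟨0, rfl⟩
    | succ n ih =>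
      obtain ⟨t, ht⟩ := ih
      have hj : ∀ j < (P n).length, st (t + j) = (n, j) := by
        intro j
        induction j with
        | zero => exact fun _ => ht
        | succ j ih =>
          intro hj
          rw [← add_assoc, hst, ih (by omega)]
          simp [step, hj]
      have h0 := hP n
      refine ⟨t + ((P n).length - 1) + 1, ?_⟩
      rw [hst, hj _ (by omega)]
      have : ¬ (P n).length - 1 + 1 < (P n).length := by omega
      simp [step, this]

lemma ConnSet.exists_walk_length_pos {Q : Set V} (hQ : ConnSet X Q) (hw : Wide X Q) {x y : V}
    (hx : x ∈ Q) (hy : y ∈ Q) :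
    ∃ p : X.Walk x y, 0 < p.length ∧ ∀ z ∈ p.support, z ∈ Q := by
  obtain ⟨z, hz, hzx⟩ := hw.exists_ne x
  obtain ⟨p, hp⟩ := hQ.exists_walk hx hz
  obtain ⟨q, hq⟩ := hQ.exists_walk hz hy
  refine ⟨p.append q, ?_, fun v hv => ?_⟩
  · have : p.length ≠ 0 := fun h => hzx (Walk.eq_of_length_eq_zero h).symm
    rw [Walk.length_append]
    omega
  · exact ((Walk.mem_support_append_iff _ _).1 hv).elim (hp v) (hq v)

end Rays

theorem statement_4 {V : Type*} (X : SimpleGraph V)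
    (hinf : Infinite V) (hconn : X.Connected)
    (hlf : ∀ v : V, (X.neighborSet v).Finite)
    (htrans : ∀ u v : V, ∃ φ : X ≃g X, φ u = v)
    (σ : ℝ) (hσ : 0 < σ) (hubq : UBQ X σ)
    (ρ : ℤ → V) (hρ : IsBiQuasiGeodesic X ρ)
    (U : Set V) (hU : IsCompOf X U ((gnbhd X (Set.range ρ) σ)ᶜ)) (hUw : Wide X U) :
    ∃ p : ℕ → V, IsRay X p ∧ Set.range p ⊆ U ∧ DivergesFrom X p (Set.range ρ) := by
  choose W hWU hW hWw using hubq.exists_wide_subset hσ hconn hlf htrans hρ hU hUw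
  have hanti : ∀ k, W (k + 1) ⊆ W k := by
    intro k
    obtain ⟨x, hx⟩ := (hW (k + 1)).2.1
    have hsub : (gnbhd X (Set.range ρ) (σ + (k + 1 : ℕ)))ᶜ ⊆
        (gnbhd X (Set.range ρ) (σ + k))ᶜ :=
      Set.compl_subset_compl.2 (gnbhd_mono X _ (by push_cast; linarith))
    have hσk : (gnbhd X (Set.range ρ) (σ + k))ᶜ ⊆ (gnbhd X (Set.range ρ) σ)ᶜ :=
      Set.compl_subset_compl.2 (gnbhd_mono X _ (by simp))
    have h := subset_compOf ((hW (k + 1)).1.trans hsub) (hW (k + 1)).2.2.1 hx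
    have hC := isCompOf_compOf (X := X) (hsub ((hW (k + 1)).1 hx))
    have hCU := hU.subset_of_connSet (hC.1.trans hσk) hC.2.2.1
      ⟨x, hWU _ hx, mem_compOf_self (hsub ((hW (k + 1)).1 hx))⟩
    rwa [hubq.eq_of_subset hσ hconn hlf htrans hρ hU.2.2.1 hU.1 hC ((hWw (k + 1)).mono h)
      (hW k) (hWw k) hCU (hWU k)] at h
  choose w hw using fun k => (hW k).2.1
  choose P hPpos hPW using fun k =>
    (hW k).2.2.1.exists_walk_length_pos (hWw k) (hw k) (hanti k (hw (k + 1)))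
  obtain ⟨p, κ, hp, hκ, hκ', hpP⟩ := exists_ray_of_walks P hPpos
  refine ⟨p, hp, ?_, fun M => ?_⟩
  · rintro _ ⟨t, rfl⟩
    exact hWU _ (hPW _ _ (hpP t))
  · obtain ⟨n, hn⟩ := exists_nat_ge M
    obtain ⟨N, hN⟩ := hκ' n
    refine ⟨N, fun t ht a ha => lt_of_not_ge fun h => ?_⟩
    refine (hW _).1 (hPW _ _ (hpP t)) ⟨a, ha, h.trans ?_⟩
    have : (n : ℝ) ≤ κ t := by exact_mod_cast hN.trans (hκ ht)
    linarith
end
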